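/- arXiv:2208.07072 — 2 statements merged into one kernel-verified Lean document; each statement's English description precedes it below -/
import Mathlib

section
/- Let n ≥ 2, let U ⊆ ℝⁿ be open, let f ∈ C^∞(U, ℝⁿ), and let Ψ ∈ C¹([0,∞), [0,∞)). Then there exists a constant C > 0 depending only on n such that for every nonnegative test function η ∈ C_c^∞(U, [0,∞)) one has | ∫_U η(x)ⁿ · [ n·Ψ(|f(x)|²) + 2·|f(x)|²·Ψ'(|f(x)|²) ] · J_f(x) dx | ≤ C · ∫_U η(x)^{n-1} · |∇η(x)| · |f(x)| · Ψ(|f(x)|²) · ‖Df(x)‖^{n-1} dx. -/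
open MeasureTheory Metric Set
open scoped Topology ENNReal NNReal

/-- The Jacobian matrix of `f` at `x`: the `(i,j)` entry is the partial
derivative `∂ⱼ fᵢ (x)`, so the `i`-th row is the gradient of the `i`-th
component function `fᵢ`. -/
noncomputable def jacobianMatrix {n : ℕ}
    (f : EuclideanSpace ℝ (Fin n) → EuclideanSpace ℝ (Fin n))
    (x : EuclideanSpace ℝ (Fin n)) : Matrix (Fin n) (Fin n) ℝ :=
  Matrix.of fun i j => fderiv ℝ f x (EuclideanSpace.single j (1 : ℝ)) i

/-- The gradient (as a vector of partial derivatives) of a scalar function. -/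
noncomputable def gradVec {n : ℕ}
    (η : EuclideanSpace ℝ (Fin n) → ℝ) (x : EuclideanSpace ℝ (Fin n)) : Fin n → ℝ :=
  fun j => fderiv ℝ η x (EuclideanSpace.single j (1 : ℝ))

/-- The cofactor matrix of a square matrix: the transpose of the adjugate. -/
noncomputable def cofMatrix {n : ℕ} (A : Matrix (Fin n) (Fin n) ℝ) :
    Matrix (Fin n) (Fin n) ℝ := (Matrix.adjugate A).transpose

/-- The operator norm of a matrix, viewed as a linear map between Euclidean spaces. -/
noncomputable def matOpNorm {n : ℕ} (A : Matrix (Fin n) (Fin n) ℝ) : ℝ :=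
  ‖LinearMap.toContinuousLinearMap (Matrix.toEuclideanLin A)‖

theorem Matrix.det_updateRow_eq_sum {n R : Type*} [Fintype n] [DecidableEq n] [CommRing R]
    (A : Matrix n n R) (i : n) (v : n → R) :
    (A.updateRow i v).det = ∑ j, v j * (A.updateRow i (Pi.single j 1)).det := by
  rw [← Matrix.cramer_transpose_apply, Matrix.cramer_eq_adjugate_mulVec,
    ← Matrix.adjugate_transpose]
  simp only [Matrix.mulVec, dotProduct, Matrix.transpose_apply, Matrix.adjugate_apply, mul_comm]

theorem Matrix.det_updateRow_updateRow_swap {n R : Type*} [Fintype n] [DecidableEq n] [CommRing R]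
    (A : Matrix n n R) {i k : n} (hik : i ≠ k) (u v : n → R) :
    ((A.updateRow i u).updateRow k v).det = -((A.updateRow i v).updateRow k u).det := by
  have h := (Matrix.detRowAlternating : (n → R) [⋀^n]→ₗ[R] R).map_swap
    ((A.updateRow i v).updateRow k u) hik
  refine Eq.trans (congrArg _ ?_) h
  ext r c
  change _ = ((A.updateRow i v).updateRow k u) (Equiv.swap i k r) c
  rcases eq_or_ne r k with rfl | hrk
  · simp [hik]
  · rcases eq_or_ne r i with rfl | hri
    · simp [hik]
    · simp [Matrix.updateRow_apply, Equiv.swap_apply_of_ne_of_ne hri hrk, hri, hrk]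

theorem Matrix.sum_det_updateRow_updateRow_eq_zero {n : Type*} [Fintype n] [DecidableEq n]
    (A H : Matrix n n ℝ) (hH : H.IsSymm) {i k : n} (hik : i ≠ k) :
    ∑ j, ((A.updateRow i (Pi.single j 1)).updateRow k (H j)).det = 0 := by
  have key : ∑ j, ((A.updateRow i (Pi.single j 1)).updateRow k (H j)).det =
      -∑ j, ((A.updateRow i (Pi.single j 1)).updateRow k (H j)).det := by
    simp only [Matrix.det_updateRow_eq_sum _ k (H _)]
    conv_rhs => rw [Finset.sum_comm]
    rw [← Finset.sum_neg_distrib]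
    refine Finset.sum_congr rfl fun j _ => ?_
    rw [← Finset.sum_neg_distrib]
    refine Finset.sum_congr rfl fun l _ => ?_
    rw [A.det_updateRow_updateRow_swap hik, hH.apply]
    ring
  linarith

theorem hasFDerivAt_matrix_det {E n : Type*} [NormedAddCommGroup E] [NormedSpace ℝ E] [Fintype n]
    [DecidableEq n] {M : E → Matrix n n ℝ} {M' : n → n → E →L[ℝ] ℝ} {x : E}
    (hM : ∀ k l, HasFDerivAt (fun y => M y k l) (M' k l) x) :
    ∃ D : E →L[ℝ] ℝ, HasFDerivAt (fun y => (M y).det) D x ∧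
      ∀ v, D v = ∑ k, ((M x).updateRow k fun l => M' k l v).det := by
  let d : ContinuousMultilinearMap ℝ (fun _ : n => n → ℝ) ℝ :=
    { (Matrix.detRowAlternating : (n → ℝ) [⋀^n]→ₗ[ℝ] ℝ).toMultilinearMap with
      cont := Continuous.matrix_det continuous_id }
  have hrow : ∀ k, HasFDerivAt (fun y => M y k) (ContinuousLinearMap.pi (M' k)) x :=
    fun k => hasFDerivAt_pi.2 (hM k)
  refine ⟨_, HasFDerivAt.multilinear_comp (f := d) hrow, fun v => ?_⟩
  rw [sum_apply]
  rfl

theorem hasFDerivAt_jacobianMatrix {n : ℕ}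
    {f : EuclideanSpace ℝ (Fin n) → EuclideanSpace ℝ (Fin n)} {x : EuclideanSpace ℝ (Fin n)}
    (hf : ContDiffAt ℝ 2 f x) (k l : Fin n) :
    HasFDerivAt (fun y => jacobianMatrix f y k l)
      ((EuclideanSpace.proj k : EuclideanSpace ℝ (Fin n) →L[ℝ] ℝ) ∘L
        (fderiv ℝ (fderiv ℝ f) x).flip (EuclideanSpace.single l 1)) x := by
  have h : HasFDerivAt (fderiv ℝ f) (fderiv ℝ (fderiv ℝ f) x) x :=
    ((hf.fderiv_right (m := 1) (by norm_num)).differentiableAt (by norm_num)).hasFDerivAt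
  exact (EuclideanSpace.proj k : EuclideanSpace ℝ (Fin n) →L[ℝ] ℝ).hasFDerivAt.comp x
    (((ContinuousLinearMap.apply ℝ (EuclideanSpace ℝ (Fin n))
      (EuclideanSpace.single l (1 : ℝ))).hasFDerivAt).comp x h)

/-- **Piola identity**: the cofactor matrix of a Jacobian matrix is divergence free. -/
theorem sum_fderiv_adjugate_jacobianMatrix {n : ℕ}
    {f : EuclideanSpace ℝ (Fin n) → EuclideanSpace ℝ (Fin n)} {x : EuclideanSpace ℝ (Fin n)}
    (hf : ContDiffAt ℝ 2 f x) (i : Fin n) :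
    ∑ j, fderiv ℝ (fun y => (jacobianMatrix f y).adjugate j i) x (EuclideanSpace.single j 1)
      = 0 := by
  have hder : ∀ j, fderiv ℝ (fun y => (jacobianMatrix f y).adjugate j i) x
      (EuclideanSpace.single j 1) = ∑ k, if i = k then 0 else
        (((jacobianMatrix f x).updateRow i (Pi.single j 1)).updateRow k fun l =>
          fderiv ℝ (fderiv ℝ f) x (EuclideanSpace.single j 1) (EuclideanSpace.single l 1) k).det := by
    intro j
    simp only [Matrix.adjugate_apply]
    obtain ⟨D, hD, hDv⟩ := hasFDerivAt_matrix_det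
      (M := fun y => (jacobianMatrix f y).updateRow i (Pi.single j 1))
      (M' := fun k l => if i = k then 0 else
        ((EuclideanSpace.proj k : EuclideanSpace ℝ (Fin n) →L[ℝ] ℝ) ∘L
        (fderiv ℝ (fderiv ℝ f) x).flip (EuclideanSpace.single l 1))) (x := x) (by
        intro k l
        by_cases hik : i = k
        · subst hik
          simpa using hasFDerivAt_const _ _
        · simpa [hik, Matrix.updateRow_apply, Ne.symm hik] using hasFDerivAt_jacobianMatrix hf k l)
    rw [hD.fderiv, hDv]
    refine Finset.sum_congr rfl fun k _ => ?_
    split_ifs with hik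
    · exact Matrix.det_eq_zero_of_row_eq_zero k (by simp)
    · rfl
  simp only [hder]
  rw [Finset.sum_comm]
  refine Finset.sum_eq_zero fun k _ => ?_
  split_ifs with hik
  · simp
  · refine Matrix.sum_det_updateRow_updateRow_eq_zero (jacobianMatrix f x)
      (Matrix.of fun j l => fderiv ℝ (fderiv ℝ f) x (EuclideanSpace.single j 1)
        (EuclideanSpace.single l 1) k) ?_ hik
    ext a b
    simp only [Matrix.transpose_apply, Matrix.of_apply]
    rw [(hf.isSymmSndFDerivAt (by simp)).eq]

theorem ContDiffAt.adjugate_jacobianMatrix {n : ℕ}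
    {f : EuclideanSpace ℝ (Fin n) → EuclideanSpace ℝ (Fin n)} {x : EuclideanSpace ℝ (Fin n)}
    (hf : ContDiffAt ℝ 2 f x) (j i : Fin n) :
    ContDiffAt ℝ 1 (fun y => (jacobianMatrix f y).adjugate j i) x := by
  have h : ContDiffAt ℝ 1 (fderiv ℝ f) x := hf.fderiv_right (by norm_num)
  have hJ : ∀ k l, ContDiffAt ℝ 1 (fun y => jacobianMatrix f y k l) x := fun k l =>
    (EuclideanSpace.proj k : EuclideanSpace ℝ (Fin n) →L[ℝ] ℝ).contDiff.contDiffAt.comp x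
      (h.clm_apply contDiffAt_const)
  simp only [Matrix.adjugate_apply, Matrix.det_apply]
  refine ContDiffAt.sum fun σ _ => ContDiffAt.const_smul _ (contDiffAt_prod fun k _ => ?_)
  simp only [Matrix.updateRow_apply]
  split_ifs
  · exact contDiffAt_const
  · exact hJ _ _

theorem abs_adjugate_jacobianMatrix_le {n : ℕ} (hn : 1 ≤ n)
    (f : EuclideanSpace ℝ (Fin n) → EuclideanSpace ℝ (Fin n)) (x : EuclideanSpace ℝ (Fin n))
    (j i : Fin n) :
    |(jacobianMatrix f x).adjugate j i| ≤ (n - 1).factorial * ‖fderiv ℝ f x‖ ^ (n - 1) := by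
  obtain ⟨m, rfl⟩ : ∃ m, n = m + 1 := ⟨n - 1, by omega⟩
  rw [Matrix.adjugate_fin_succ_eq_det_submatrix, abs_mul, abs_pow, abs_neg, abs_one, one_pow,
    one_mul]
  have h := Matrix.det_le (abv := AbsoluteValue.abs) (x := ‖fderiv ℝ f x‖)
    (A := (jacobianMatrix f x).submatrix i.succAbove j.succAbove) (by
      intro k l
      simp only [Matrix.submatrix_apply, AbsoluteValue.abs_apply, jacobianMatrix, Matrix.of_apply]
      refine (PiLp.norm_apply_le (fderiv ℝ f x (EuclideanSpace.single _ 1)) _).trans ?_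
      refine (ContinuousLinearMap.le_opNorm _ _).trans ?_
      simp)
  simpa using h

theorem inner_fderiv_single {n : ℕ}
    (f : EuclideanSpace ℝ (Fin n) → EuclideanSpace ℝ (Fin n)) (x : EuclideanSpace ℝ (Fin n))
    (j : Fin n) :
    inner ℝ (f x) (fderiv ℝ f x (EuclideanSpace.single j 1)) =
      ∑ k, f x k * jacobianMatrix f x k j := by
  simp [PiLp.inner_apply, jacobianMatrix, mul_comm]

theorem sum_inner_fderiv_mul_adjugate {n : ℕ}
    (f : EuclideanSpace ℝ (Fin n) → EuclideanSpace ℝ (Fin n)) (x : EuclideanSpace ℝ (Fin n)) :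
    ∑ j, inner ℝ (f x) (fderiv ℝ f x (EuclideanSpace.single j 1)) *
        ∑ i, (jacobianMatrix f x).adjugate j i * f x i =
      ‖f x‖ ^ 2 * (jacobianMatrix f x).det := by
  set A := jacobianMatrix f x with hA
  have h : Matrix.vecMul (f x) A ⬝ᵥ Matrix.mulVec A.adjugate (f x) = ‖f x‖ ^ 2 * A.det := by
    rw [Matrix.dotProduct_mulVec, Matrix.vecMul_vecMul, Matrix.mul_adjugate, Matrix.vecMul_smul,
      Matrix.vecMul_one, smul_dotProduct, EuclideanSpace.real_norm_sq_eq, smul_eq_mul, mul_comm]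
    simp [dotProduct, sq]
  rw [← h]
  simp only [inner_fderiv_single, dotProduct, Matrix.vecMul, Matrix.mulVec, ← hA]

/-- The divergence of the vector field `φ • adj(Df) f`. -/
theorem sum_fderiv_mul_adjugate_mulVec {n : ℕ}
    {f : EuclideanSpace ℝ (Fin n) → EuclideanSpace ℝ (Fin n)} {x : EuclideanSpace ℝ (Fin n)}
    (hf : ContDiffAt ℝ 2 f x) {φ : EuclideanSpace ℝ (Fin n) → ℝ} (hφ : DifferentiableAt ℝ φ x) :
    ∑ j, fderiv ℝ (fun y => φ y * ∑ i, (jacobianMatrix f y).adjugate j i * f y i) x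
        (EuclideanSpace.single j 1) =
      ∑ j, fderiv ℝ φ x (EuclideanSpace.single j 1) *
        ∑ i, (jacobianMatrix f x).adjugate j i * f x i +
      φ x * (n * (jacobianMatrix f x).det) := by
  have hfi : ∀ i, HasFDerivAt (fun y => f y i)
      ((EuclideanSpace.proj i : EuclideanSpace ℝ (Fin n) →L[ℝ] ℝ) ∘L fderiv ℝ f x) x := fun i =>
    (EuclideanSpace.proj i : EuclideanSpace ℝ (Fin n) →L[ℝ] ℝ).hasFDerivAt.comp x
      (hf.differentiableAt (by norm_num)).hasFDerivAt
  have hadj : ∀ j i, HasFDerivAt (fun y => (jacobianMatrix f y).adjugate j i)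
      (fderiv ℝ (fun y => (jacobianMatrix f y).adjugate j i) x) x := fun j i =>
    ((hf.adjugate_jacobianMatrix j i).differentiableAt (by norm_num)).hasFDerivAt
  have hV : ∀ j, fderiv ℝ (fun y => φ y * ∑ i, (jacobianMatrix f y).adjugate j i * f y i) x
        (EuclideanSpace.single j 1) =
      fderiv ℝ φ x (EuclideanSpace.single j 1) *
        ∑ i, (jacobianMatrix f x).adjugate j i * f x i +
      φ x * (∑ i, (jacobianMatrix f x).adjugate j i * jacobianMatrix f x i j +
        ∑ i, f x i * fderiv ℝ (fun y => (jacobianMatrix f y).adjugate j i) x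
          (EuclideanSpace.single j 1)) := by
    intro j
    rw [(hφ.hasFDerivAt.fun_mul (HasFDerivAt.fun_sum (u := Finset.univ) fun i _ =>
      (hadj j i).fun_mul (hfi i))).fderiv]
    simp only [add_apply, smul_apply, sum_apply, smul_eq_mul, Finset.sum_add_distrib,
      ContinuousLinearMap.comp_apply]
    rw [add_comm, mul_comm (fderiv ℝ φ x _)]
    rfl
  simp only [hV, Finset.sum_add_distrib, ← Finset.mul_sum]
  have htr : ∑ j, ∑ i, (jacobianMatrix f x).adjugate j i * jacobianMatrix f x i j =
      n * (jacobianMatrix f x).det := by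
    have h := congrArg Matrix.trace (Matrix.adjugate_mul (jacobianMatrix f x))
    simpa [Matrix.trace, Matrix.mul_apply] using h
  have hP : ∑ j, ∑ i, f x i * fderiv ℝ (fun y => (jacobianMatrix f y).adjugate j i) x
      (EuclideanSpace.single j 1) = 0 := by
    rw [Finset.sum_comm]
    simp only [← Finset.mul_sum, sum_fderiv_adjugate_jacobianMatrix hf, mul_zero,
      Finset.sum_const_zero]
  rw [htr, hP, add_zero]

theorem hasFDerivAt_comp_norm_sq {E F : Type*} [NormedAddCommGroup E] [NormedSpace ℝ E]
    [NormedAddCommGroup F] [InnerProductSpace ℝ F] {f : E → F} {x : E}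
    (hf : DifferentiableAt ℝ f x) {Ψ : ℝ → ℝ} (hΨ : DifferentiableOn ℝ Ψ (Set.Ici 0)) :
    HasFDerivAt (fun y => Ψ (‖f y‖ ^ 2))
      (derivWithin Ψ (Set.Ici 0) (‖f x‖ ^ 2) • 2 • (innerSL ℝ (f x)).comp (fderiv ℝ f x)) x := by
  have h1 := (hΨ (‖f x‖ ^ 2) (Set.mem_Ici.2 (by positivity))).hasDerivWithinAt
  have h2 := hf.hasFDerivAt.norm_sq
  rw [← hasFDerivWithinAt_univ] at h2 ⊢
  exact h1.comp_hasFDerivWithinAt x h2 fun y _ => Set.mem_Ici.2 (by positivity)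

theorem contDiffAt_comp_norm_sq {E F : Type*} [NormedAddCommGroup E] [NormedSpace ℝ E]
    [NormedAddCommGroup F] [InnerProductSpace ℝ F] {f : E → F} {x : E}
    (hf : ContDiffAt ℝ 1 f x) {Ψ : ℝ → ℝ} (hΨ : ContDiffOn ℝ 1 Ψ (Set.Ici 0)) :
    ContDiffAt ℝ 1 (fun y => Ψ (‖f y‖ ^ 2)) x := by
  have h1 := hΨ (‖f x‖ ^ 2) (Set.mem_Ici.2 (by positivity))
  have h2 := hf.norm_sq ℝ
  rw [← contDiffWithinAt_univ] at h2 ⊢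
  exact h1.comp x h2 fun y _ => Set.mem_Ici.2 (by positivity)

theorem integral_fderiv_apply_eq_zero {E : Type*} [NormedAddCommGroup E] [NormedSpace ℝ E]
    [FiniteDimensional ℝ E] [MeasurableSpace E] [BorelSpace E] (μ : Measure E)
    [μ.IsAddHaarMeasure] {g : E → ℝ} (hg : ContDiff ℝ 1 g) (hc : HasCompactSupport g) (v : E) :
    ∫ x, fderiv ℝ g x v ∂μ = 0 := by
  have h := integral_mul_fderiv_eq_neg_fderiv_mul_of_integrable (μ := μ) (f := fun _ => (1 : ℝ))
    (g := g) (v := v) (by simp)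
    (by
      simpa using ((hg.continuous_fderiv (by norm_num)).clm_apply
        continuous_const).integrable_of_hasCompactSupport (hc.fderiv_apply ℝ v))
    (by simpa using hg.continuous.integrable_of_hasCompactSupport hc)
    (by simp) (fun x _ => hg.differentiable (by norm_num) x)
  simpa using h

/-- Pointwise form of the integration by parts behind the estimate. -/
theorem sum_fderiv_pow_mul_comp_norm_sq_mul_adjugate {n : ℕ}
    {f : EuclideanSpace ℝ (Fin n) → EuclideanSpace ℝ (Fin n)} {x : EuclideanSpace ℝ (Fin n)}
    (hf : ContDiffAt ℝ 2 f x) {Ψ : ℝ → ℝ} (hΨ : DifferentiableOn ℝ Ψ (Set.Ici 0))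
    {η : EuclideanSpace ℝ (Fin n) → ℝ} (hη : DifferentiableAt ℝ η x) :
    ∑ j, fderiv ℝ (fun y => η y ^ n * Ψ (‖f y‖ ^ 2) *
        ∑ i, (jacobianMatrix f y).adjugate j i * f y i) x (EuclideanSpace.single j 1) =
      η x ^ n * ((n : ℝ) * Ψ (‖f x‖ ^ 2) +
        2 * ‖f x‖ ^ 2 * derivWithin Ψ (Set.Ici 0) (‖f x‖ ^ 2)) * (jacobianMatrix f x).det +
      n * η x ^ (n - 1) * Ψ (‖f x‖ ^ 2) * ∑ j, fderiv ℝ η x (EuclideanSpace.single j 1) *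
        ∑ i, (jacobianMatrix f x).adjugate j i * f x i := by
  have hφ := (hη.hasFDerivAt.pow n).fun_mul
    (hasFDerivAt_comp_norm_sq (hf.differentiableAt (by norm_num)) hΨ)
  have hφj : ∀ j, fderiv ℝ (fun y => η y ^ n * Ψ (‖f y‖ ^ 2)) x (EuclideanSpace.single j 1) =
      η x ^ n * (derivWithin Ψ (Set.Ici 0) (‖f x‖ ^ 2) *
        (2 * inner ℝ (f x) (fderiv ℝ f x (EuclideanSpace.single j 1)))) +
      Ψ (‖f x‖ ^ 2) * (n * η x ^ (n - 1) * fderiv ℝ η x (EuclideanSpace.single j 1)) := by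
    intro j
    refine (congrArg (fun L => L (EuclideanSpace.single j 1)) hφ.fderiv).trans ?_
    simp [mul_assoc]
  rw [sum_fderiv_mul_adjugate_mulVec hf hφ.differentiableAt]
  simp only [hφj, add_mul, Finset.sum_add_distrib]
  have h1 := sum_inner_fderiv_mul_adjugate f x
  simp only [mul_assoc, ← Finset.mul_sum] at h1 ⊢
  rw [h1]
  ring

theorem abs_sum_fderiv_mul_adjugate_le {n : ℕ} (hn : 1 ≤ n)
    (f : EuclideanSpace ℝ (Fin n) → EuclideanSpace ℝ (Fin n))
    (η : EuclideanSpace ℝ (Fin n) → ℝ) (x : EuclideanSpace ℝ (Fin n)) :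
    |∑ j, fderiv ℝ η x (EuclideanSpace.single j 1) *
        ∑ i, (jacobianMatrix f x).adjugate j i * f x i| ≤
      n ^ 2 * (n - 1).factorial * (‖fderiv ℝ η x‖ * ‖f x‖ * ‖fderiv ℝ f x‖ ^ (n - 1)) := by
  have h1 : ∀ j : Fin n, |∑ i, (jacobianMatrix f x).adjugate j i * f x i| ≤
      n * ((n - 1).factorial * ‖fderiv ℝ f x‖ ^ (n - 1) * ‖f x‖) := by
    intro j
    refine (Finset.abs_sum_le_sum_abs _ _).trans
      ((Finset.sum_le_card_nsmul _ _ _ fun i _ => ?_).trans_eq (by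
        rw [Finset.card_fin, nsmul_eq_mul]))
    rw [abs_mul]
    exact mul_le_mul (abs_adjugate_jacobianMatrix_le hn f x j i) (PiLp.norm_apply_le (f x) i)
      (abs_nonneg _) (by positivity)
  refine (Finset.abs_sum_le_sum_abs _ _).trans
    ((Finset.sum_le_card_nsmul _ _ (‖fderiv ℝ η x‖ *
      (n * ((n - 1).factorial * ‖fderiv ℝ f x‖ ^ (n - 1) * ‖f x‖))) fun j _ => ?_).trans_eq ?_)
  · rw [abs_mul]
    refine mul_le_mul ?_ (h1 j) (abs_nonneg _) (norm_nonneg _)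
    simpa using (fderiv ℝ η x).le_opNorm (EuclideanSpace.single j 1)
  · rw [Finset.card_fin, nsmul_eq_mul]
    ring

theorem integrable_of_continuousAt_of_forall_notMem {E : Type*} [TopologicalSpace E] [T2Space E]
    [MeasurableSpace E] [OpensMeasurableSpace E] {μ : Measure E} [IsFiniteMeasureOnCompacts μ]
    {K : Set E} (hK : IsCompact K) {g : E → ℝ} (hg : ∀ x ∈ K, ContinuousAt g x)
    (h0 : ∀ x ∉ K, g x = 0) : Integrable g μ := by
  refine Continuous.integrable_of_hasCompactSupport ?_ (HasCompactSupport.intro hK fun x => h0 x)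
  refine continuous_iff_continuousAt.2 fun x => ?_
  by_cases hx : x ∈ K
  · exact hg x hx
  · exact (continuousAt_const (y := (0 : ℝ))).congr (by
      filter_upwards [hK.isClosed.isOpen_compl.mem_nhds hx] with y hy using (h0 y hy).symm)

theorem contDiff_of_contDiffAt_of_forall_notMem {E : Type*} [NormedAddCommGroup E]
    [NormedSpace ℝ E] {K : Set E} (hK : IsClosed K) {g : E → ℝ} {k : ℕ}
    (hg : ∀ x ∈ K, ContDiffAt ℝ k g x) (h0 : ∀ x ∉ K, g x = 0) : ContDiff ℝ k g := by
  refine contDiff_iff_contDiffAt.2 fun x => ?_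
  by_cases hx : x ∈ K
  · exact hg x hx
  · exact (contDiffAt_const (c := (0 : ℝ))).congr_of_eventuallyEq (by
      filter_upwards [hK.isOpen_compl.mem_nhds hx] with y hy using h0 y hy)

/-- (Onninen–Zhong estimate.) For each `n ≥ 2` there is a
constant `C > 0` depending only on `n` such that for every open `U ⊆ ℝⁿ`,
every `f ∈ C^∞(U,ℝⁿ)`, every `Ψ ∈ C¹([0,∞),[0,∞))` and every nonnegative
`η ∈ C_c^∞(U,[0,∞))`:
`|∫_U ηⁿ (nΨ(|f|²)+2|f|²Ψ'(|f|²)) J_f| ≤ C ∫_U η^{n-1} |∇η| |f| Ψ(|f|²) ‖Df‖^{n-1}`. -/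
theorem stmt8 (n : ℕ) (hn : 2 ≤ n) :
    ∃ C : ℝ, 0 < C ∧
      ∀ (U : Set (EuclideanSpace ℝ (Fin n))), IsOpen U →
      ∀ (f : EuclideanSpace ℝ (Fin n) → EuclideanSpace ℝ (Fin n)), ContDiffOn ℝ (⊤ : ℕ∞) f U →
      ∀ (Ψ : ℝ → ℝ), ContDiffOn ℝ 1 Ψ (Set.Ici 0) → (∀ s ∈ Set.Ici (0 : ℝ), 0 ≤ Ψ s) →
      ∀ (η : EuclideanSpace ℝ (Fin n) → ℝ), ContDiff ℝ (⊤ : ℕ∞) η → HasCompactSupport η →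
        tsupport η ⊆ U → (∀ x, 0 ≤ η x) →
      |∫ x in U, η x ^ n *
          ((n : ℝ) * Ψ (‖f x‖ ^ 2) + 2 * ‖f x‖ ^ 2 * derivWithin Ψ (Set.Ici 0) (‖f x‖ ^ 2)) *
          (jacobianMatrix f x).det| ≤
        C * ∫ x in U, η x ^ (n - 1) * ‖fderiv ℝ η x‖ * ‖f x‖ * Ψ (‖f x‖ ^ 2) *
          ‖fderiv ℝ f x‖ ^ (n - 1) := by
  have hn1 : 1 ≤ n := by omega
  have hn0 : n ≠ 0 := by omega
  refine ⟨n * (n ^ 2 * (n - 1).factorial), by positivity, ?_⟩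
  intro U hU f hf Ψ hΨ hΨ0 η hη hηc hηU hη0
  have hfx : ∀ x ∈ tsupport η, ContDiffAt ℝ 2 f x := fun x hx =>
    (hf.contDiffAt (hU.mem_nhds (hηU hx))).of_le (WithTop.coe_le_coe.2 le_top)
  have hη1 : ContDiff ℝ 1 η := hη.of_le (by exact_mod_cast le_top)
  have hηz : ∀ x ∉ tsupport η, η x = 0 := fun x hx => image_eq_zero_of_notMem_tsupport hx
  have hdηz : ∀ x ∉ tsupport η, fderiv ℝ η x = 0 := fun x hx =>
    image_eq_zero_of_notMem_tsupport fun h => hx (tsupport_fderiv_subset ℝ h)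
  have hΨf : ∀ x ∈ tsupport η, ContDiffAt ℝ 1 (fun y => Ψ (‖f y‖ ^ 2)) x := fun x hx =>
    contDiffAt_comp_norm_sq ((hfx x hx).of_le (by norm_num)) hΨ
  have hadjf : ∀ j, ∀ x ∈ tsupport η,
      ContDiffAt ℝ 1 (fun y => ∑ i, (jacobianMatrix f y).adjugate j i * f y i) x := by
    intro j x hx
    refine ContDiffAt.sum fun i _ => ((hfx x hx).adjugate_jacobianMatrix j i).mul ?_
    exact (EuclideanSpace.proj i : EuclideanSpace ℝ (Fin n) →L[ℝ] ℝ).contDiff.contDiffAt.comp x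
      ((hfx x hx).of_le (by norm_num))
  set V : Fin n → EuclideanSpace ℝ (Fin n) → ℝ := fun j y => η y ^ n * Ψ (‖f y‖ ^ 2) *
    ∑ i, (jacobianMatrix f y).adjugate j i * f y i with hV
  set R : EuclideanSpace ℝ (Fin n) → ℝ := fun x => n * η x ^ (n - 1) * Ψ (‖f x‖ ^ 2) *
    ∑ j, fderiv ℝ η x (EuclideanSpace.single j 1) *
      ∑ i, (jacobianMatrix f x).adjugate j i * f x i with hR
  have hVz : ∀ j, ∀ x ∉ tsupport η, V j x = 0 := fun j x hx => by simp [hV, hηz x hx, hn0]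
  have hVsupp : ∀ j, tsupport (V j) ⊆ tsupport η := fun j =>
    closure_minimal (fun x hx => by_contra fun h => hx (hVz j x h)) isClosed_closure
  have hVdiff : ∀ j, ContDiff ℝ 1 (V j) := fun j => contDiff_of_contDiffAt_of_forall_notMem
    (k := 1) (isClosed_tsupport η) (fun x hx =>
    ((hη1.contDiffAt.pow n).mul (hΨf x hx)).mul (hadjf j x hx)) (hVz j)
  have hVc : ∀ j, HasCompactSupport (V j) := fun j => HasCompactSupport.intro hηc (hVz j)
  have hdV : ∀ j, Integrable fun x => fderiv ℝ (V j) x (EuclideanSpace.single j 1) := fun j =>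
    (((hVdiff j).continuous_fderiv (by norm_num)).clm_apply
      continuous_const).integrable_of_hasCompactSupport ((hVc j).fderiv_apply ℝ _)
  have hdη : Continuous (fderiv ℝ η) := hη1.continuous_fderiv (by norm_num)
  have hRint : Integrable R := by
    refine integrable_of_continuousAt_of_forall_notMem hηc (fun x hx => ?_) fun x hx => by
      simp [hR, hdηz x hx]
    refine ((continuousAt_const.mul (hη.continuous.continuousAt.pow _)).mul
      (hΨf x hx).continuousAt).mul (tendsto_finsetSum _ fun j _ => ?_)
    exact (hdη.clm_apply continuous_const).continuousAt.mul (hadjf j x hx).continuousAt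
  have hBint : Integrable fun x => η x ^ (n - 1) * ‖fderiv ℝ η x‖ * ‖f x‖ * Ψ (‖f x‖ ^ 2) *
      ‖fderiv ℝ f x‖ ^ (n - 1) := by
    refine integrable_of_continuousAt_of_forall_notMem hηc (fun x hx => ?_) fun x hx => by
      simp [hdηz x hx]
    have hdf : ContinuousAt (fderiv ℝ f) x :=
      ((hfx x hx).fderiv_right (m := 1) (by norm_num)).continuousAt
    exact ((((hη.continuous.continuousAt.pow _).mul hdη.continuousAt.norm).mul
      (hfx x hx).continuousAt.norm).mul (hΨf x hx).continuousAt).mul (hdf.norm.pow _)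
  have hG : ∀ x, η x ^ n *
      ((n : ℝ) * Ψ (‖f x‖ ^ 2) + 2 * ‖f x‖ ^ 2 * derivWithin Ψ (Set.Ici 0) (‖f x‖ ^ 2)) *
      (jacobianMatrix f x).det =
      ∑ j, fderiv ℝ (V j) x (EuclideanSpace.single j 1) - R x := by
    intro x
    by_cases hx : x ∈ tsupport η
    · rw [eq_sub_iff_add_eq]
      exact (sum_fderiv_pow_mul_comp_norm_sq_mul_adjugate (hfx x hx)
        (hΨ.differentiableOn (by norm_num)) (hη1.differentiable (by norm_num) x)).symm
    · have hdVz : ∀ j, fderiv ℝ (V j) x = 0 := fun j =>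
        image_eq_zero_of_notMem_tsupport fun h => hx (hVsupp j (tsupport_fderiv_subset ℝ h))
      simp [hηz x hx, hn0, hdVz, hR, hdηz x hx]
  have hηU' : ∀ x ∉ U, x ∉ tsupport η := fun x hx h => hx (hηU h)
  rw [setIntegral_eq_integral_of_forall_compl_eq_zero fun x hx => by
      simp [hηz x (hηU' x hx), hn0],
    setIntegral_eq_integral_of_forall_compl_eq_zero fun x hx => by
      simp [hdηz x (hηU' x hx)]]
  simp only [hG]
  rw [integral_sub (integrable_finsetSum _ fun j _ => hdV j) hRint,
    integral_finsetSum _ fun j _ => hdV j]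
  simp only [integral_fderiv_apply_eq_zero volume (hVdiff _) (hVc _), Finset.sum_const_zero,
    zero_sub, abs_neg]
  rw [← integral_const_mul]
  rw [← Real.norm_eq_abs]
  refine norm_integral_le_of_norm_le (hBint.const_mul _) (ae_of_all _ fun x => ?_)
  have hΨx : 0 ≤ Ψ (‖f x‖ ^ 2) := hΨ0 _ (Set.mem_Ici.2 (by positivity))
  have hηx : 0 ≤ η x ^ (n - 1) := pow_nonneg (hη0 x) _
  have hc : 0 ≤ n * η x ^ (n - 1) * Ψ (‖f x‖ ^ 2) := by positivity
  rw [hR, Real.norm_eq_abs, abs_mul, abs_of_nonneg hc]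
  refine (mul_le_mul_of_nonneg_left (abs_sum_fderiv_mul_adjugate_le hn1 f η x) hc).trans_eq ?_
  ring
end

section
/- Let n ≥ 2, let U ⊆ ℝⁿ be open, let R > 0 be such that the closed ball B̄(0,R) ⊆ U, let f ∈ C^∞(U, ℝⁿ), and let Ψ ∈ C¹([0,∞), [0,∞)). Then for almost every t ∈ (0, R): | ∫_{B(0,t)} [ n·Ψ(|f(x)|²) + 2·|f(x)|²·Ψ'(|f(x)|²) ] · J_f(x) dx | ≤ ∫_{∂B(0,t)} |f(x)| · Ψ(|f(x)|²) · ‖cof Df(x)‖ dH^{n-1}(x), where the boundary integral is with respect to (n-1)-dimensional Hausdorff measure on the sphere ∂B(0,t). -/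
open MeasureTheory Metric Set
open scoped Topology ENNReal NNReal

section

open scoped Pointwise

/-- Volume bound through the diameters of the coordinate projections in an orthonormal basis. -/
lemma volume_le_prod_ediam_inner {n : ℕ} {E : Type*} [NormedAddCommGroup E]
    [InnerProductSpace ℝ E] [FiniteDimensional ℝ E] [MeasurableSpace E] [BorelSpace E]
    (b : OrthonormalBasis (Fin n) ℝ E) (S : Set E) :
    volume S ≤ ∏ i, Metric.ediam ((fun x => inner ℝ (b i) x) '' S) := by
  have h1 := b.measurePreserving_repr
  have h2 := PiLp.volume_preserving_ofLp (Fin n)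
  have h3 : MeasurePreserving (fun x => WithLp.ofLp (b.repr x)) (volume : Measure E)
    (volume : Measure (Fin n → ℝ)) := h2.comp h1
  have h4 : MeasurableEmbedding (fun x => WithLp.ofLp (b.repr x)) :=
    (MeasurableEquiv.toLp 2 (Fin n → ℝ)).symm.measurableEmbedding.comp
      b.repr.toHomeomorph.measurableEmbedding
  have h5 : volume S = volume ((fun x => WithLp.ofLp (b.repr x)) '' S) := by
    rw [← h3.map_eq, h4.map_apply, preimage_image_eq _ h4.injective]
  rw [h5]
  refine (Real.volume_pi_le_prod_diam _).trans (le_of_eq ?_)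
  refine Finset.prod_congr rfl fun i _ => ?_
  rw [image_image]
  simp [b.repr_apply_apply]

lemma volume_annular_cone_le {n : ℕ} (hn : 1 ≤ n) {A : Set (EuclideanSpace ℝ (Fin n))}
    (hA : A ⊆ sphere 0 1) {δ : ℝ} (hδ : 0 < δ) (hδ1 : δ < 1) (hdiam : diam A ≤ δ) :
    volume (Ico (1 - δ) 1 • A) ≤
      ENNReal.ofReal ((diam A * (1 + δ)) ^ (n - 1) * (δ * (1 + δ))) := by
  obtain rfl | ⟨a, ha⟩ := A.eq_empty_or_nonempty
  · simp
  have hbdd : Bornology.IsBounded A := isBounded_sphere.subset hA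
  have hnorm : ∀ x ∈ A, ‖x‖ = 1 := fun x hx => by simpa using hA hx
  set D := diam A with hD
  have hD0 : 0 ≤ D := diam_nonneg
  have hdist : ∀ x ∈ A, ∀ y ∈ A, ‖x - y‖ ≤ D := fun x hx y hy => by
    rw [← dist_eq_norm]; exact dist_le_diam_of_mem hbdd hx hy
  let i₀ : Fin n := ⟨0, hn⟩
  have hort : Orthonormal ℝ (({i₀} : Set (Fin n)).domRestrict
      (fun _ => a : Fin n → EuclideanSpace ℝ (Fin n))) := by
    rw [orthonormal_iff_ite]
    rintro ⟨i, hi⟩ ⟨j, hj⟩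
    obtain rfl : i = i₀ := hi
    obtain rfl : j = i₀ := hj
    simp [hnorm a ha]
  obtain ⟨b, hb⟩ := Orthonormal.exists_orthonormalBasis_extension_of_card_eq
    (𝕜 := ℝ) (by simp) hort
  have hb0 : b i₀ = a := hb i₀ rfl
  have hne : ∀ i ≠ i₀, Metric.ediam ((fun x => inner ℝ (b i) x) '' (Ico (1 - δ) 1 • A)) ≤
      ENNReal.ofReal (D * (1 + δ)) := by
    intro i hi
    refine Metric.ediam_le ?_
    rintro _ ⟨_, ⟨s, hs, x, hx, rfl⟩, rfl⟩ _ ⟨_, ⟨s', hs', x', hx', rfl⟩, rfl⟩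
    rw [edist_dist, Real.dist_eq]
    apply ENNReal.ofReal_le_ofReal
    have hia : inner ℝ (b i) a = 0 := by rw [← hb0]; exact b.orthonormal.2 hi
    have e : inner ℝ (b i) (s • x) - inner ℝ (b i) (s' • x')
        = s * inner ℝ (b i) (x - x') + (s - s') * inner ℝ (b i) (x' - a) := by
      simp only [inner_smul_right, inner_sub_right, hia]; ring
    have c1 : |inner ℝ (b i) (x - x')| ≤ D :=
      (abs_real_inner_le_norm _ _).trans (by simpa using hdist x hx x' hx')
    have c2 : |inner ℝ (b i) (x' - a)| ≤ D :=
      (abs_real_inner_le_norm _ _).trans (by simpa using hdist x' hx' a ha)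
    have c3 : |s| ≤ 1 := abs_le.2 ⟨by linarith [hs.1], hs.2.le⟩
    have c4 : |s - s'| ≤ δ := abs_le.2 ⟨by linarith [hs.1, hs'.2], by linarith [hs.2, hs'.1]⟩
    simp only
    rw [e]
    calc _ ≤ |s| * |inner ℝ (b i) (x - x')| + |s - s'| * |inner ℝ (b i) (x' - a)| := by
          rw [← abs_mul, ← abs_mul]; exact abs_add_le _ _
      _ ≤ 1 * D + δ * D := by gcongr
      _ = D * (1 + δ) := by ring
  have he : Metric.ediam ((fun x => inner ℝ (b i₀) x) '' (Ico (1 - δ) 1 • A)) ≤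
      ENNReal.ofReal (δ * (1 + δ)) := by
    have key : ∀ s ∈ Ico (1 - δ) 1, ∀ x ∈ A, inner ℝ a (s • x) ∈ Icc ((1 - δ) * (1 - δ ^ 2)) 1 := by
      intro s hs x hx
      have h1 := norm_sub_sq_real a x
      rw [hnorm a ha, hnorm x hx] at h1
      have h2 := hdist a ha x hx
      have h3 : ‖a - x‖ ^ 2 ≤ δ ^ 2 := by gcongr; linarith
      have h4 : inner ℝ a x ≤ 1 := by nlinarith [sq_nonneg ‖a - x‖]
      have h5 : 1 - δ ^ 2 ≤ inner ℝ a x := by nlinarith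
      have h6 : 0 ≤ 1 - δ ^ 2 := by nlinarith
      rw [inner_smul_right]
      constructor
      · exact mul_le_mul hs.1 h5 h6 (by linarith [hs.1])
      · nlinarith [hs.1, hs.2]
    rw [hb0]
    refine Metric.ediam_le ?_
    rintro _ ⟨_, ⟨s, hs, x, hx, rfl⟩, rfl⟩ _ ⟨_, ⟨s', hs', x', hx', rfl⟩, rfl⟩
    rw [edist_dist]
    refine ENNReal.ofReal_le_ofReal ((Real.dist_le_of_mem_Icc (key s hs x hx)
      (key s' hs' x' hx')).trans ?_)
    nlinarith [pow_pos hδ 3]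
  calc _ ≤ _ := volume_le_prod_ediam_inner b _
    _ = Metric.ediam ((fun x => inner ℝ (b i₀) x) '' (Ico (1 - δ) 1 • A)) *
        ∏ i ∈ Finset.univ.erase i₀,
          Metric.ediam ((fun x => inner ℝ (b i) x) '' (Ico (1 - δ) 1 • A)) :=
        (Finset.mul_prod_erase _ _ (Finset.mem_univ _)).symm
    _ ≤ ENNReal.ofReal (δ * (1 + δ)) *
        ∏ i ∈ Finset.univ.erase i₀, ENNReal.ofReal (D * (1 + δ)) := by
        gcongr with i hi
        exact hne i (Finset.ne_of_mem_erase hi)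
    _ = _ := by
        rw [Finset.prod_const, Finset.card_erase_of_mem (Finset.mem_univ _), Finset.card_univ,
          Fintype.card_fin, ← ENNReal.ofReal_pow (by positivity), ← ENNReal.ofReal_mul (by positivity),
          mul_comm]

lemma toSphere_closed_le {n : ℕ} (hn : 1 ≤ n) {δ : ℝ} (hδ : 0 < δ) (hδ1 : δ < 1)
    {s : Set (sphere (0 : EuclideanSpace ℝ (Fin n)) 1)} (hs : IsClosed s)
    (hdiam : Metric.ediam s ≤ ENNReal.ofReal δ) :
    (volume : Measure (EuclideanSpace ℝ (Fin n))).toSphere s ≤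
      ENNReal.ofReal ((1 + δ) ^ n / (1 - δ) ^ (n - 1)) * Metric.ediam s ^ ((n : ℝ) - 1) := by
  set A : Set (EuclideanSpace ℝ (Fin n)) := (↑) '' s with hAdef
  have hA : A ⊆ sphere 0 1 := by rintro _ ⟨x, -, rfl⟩; exact x.2
  have hAs : Metric.ediam A = Metric.ediam s := isometry_subtype_coe.ediam_image s
  have hbdd : Bornology.IsBounded A := isBounded_sphere.subset hA
  have hD : diam A ≤ δ := by
    rw [diam, hAs]; exact ENNReal.toReal_le_of_le_ofReal hδ.le hdiam
  have hV := volume_annular_cone_le hn hA hδ hδ1 hD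
  set C := volume (Ioo (0 : ℝ) 1 • A) with hC
  have hCfin : C ≠ ⊤ := by
    refine ((measure_mono ?_).trans_lt
      (measure_ball_lt_top (μ := volume) (x := (0 : EuclideanSpace ℝ (Fin n))) (r := 1))).ne
    rintro _ ⟨r, hr, x, hx, rfl⟩
    have : ‖x‖ = 1 := by simpa using hA hx
    simp [norm_smul, this, abs_of_pos hr.1, hr.2]
  have hl : 0 < 1 - δ := by linarith
  have hsub : Ioo (0 : ℝ) 1 • A ⊆ Ico (1 - δ) 1 • A ∪ (1 - δ) • (Ioo (0 : ℝ) 1 • A) := by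
    rintro _ ⟨r, hr, x, hx, rfl⟩
    rcases le_or_gt (1 - δ) r with h | h
    · exact Or.inl ⟨r, ⟨h, hr.2⟩, x, hx, rfl⟩
    · refine Or.inr ⟨(r / (1 - δ)) • x, ⟨r / (1 - δ), ⟨div_pos hr.1 hl, (div_lt_one hl).2 h⟩,
        x, hx, rfl⟩, ?_⟩
      simp only [smul_smul]
      rw [mul_div_cancel₀ _ hl.ne']
  have h1 : C ≤ ENNReal.ofReal ((diam A * (1 + δ)) ^ (n - 1) * (δ * (1 + δ))) +
      ENNReal.ofReal ((1 - δ) ^ n) * C := by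
    refine (measure_mono hsub).trans ((measure_union_le _ _).trans (add_le_add hV ?_))
    rw [Measure.addHaar_smul]
    simp [abs_of_pos hl, hC]
  have h2 : C.toReal ≤ (diam A * (1 + δ)) ^ (n - 1) * (δ * (1 + δ)) + (1 - δ) ^ n * C.toReal := by
    have := ENNReal.toReal_mono (by finiteness) h1
    rwa [ENNReal.toReal_add (by finiteness) (by finiteness), ENNReal.toReal_mul,
      ENNReal.toReal_ofReal (by have := diam_nonneg (s := A); positivity),
      ENNReal.toReal_ofReal (by positivity)] at this
  have h3 : n * δ * (1 - δ) ^ (n - 1) ≤ 1 - (1 - δ) ^ n := by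
    have e := Commute.geom_sum₂_mul (Commute.all (1 : ℝ) (1 - δ)) n
    have : (n : ℝ) * (1 - δ) ^ (n - 1) ≤ ∑ i ∈ Finset.range n, (1 : ℝ) ^ i * (1 - δ) ^ (n - 1 - i) := by
      have := Finset.card_nsmul_le_sum (Finset.range n)
        (fun i => (1 : ℝ) ^ i * (1 - δ) ^ (n - 1 - i)) ((1 - δ) ^ (n - 1)) fun i _ => by
          rw [one_pow, one_mul]
          exact pow_le_pow_of_le_one hl.le (by linarith) (Nat.sub_le _ _)
      rwa [Finset.card_range, nsmul_eq_mul] at this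
    rw [one_pow] at e
    rw [← e]
    nlinarith
  have h4 : n * C.toReal ≤ (1 + δ) ^ n / (1 - δ) ^ (n - 1) * diam A ^ (n - 1) := by
    have hp : 0 < (1 - δ) ^ (n - 1) := by positivity
    have h5 : C.toReal * (n * δ * (1 - δ) ^ (n - 1)) ≤
        (diam A * (1 + δ)) ^ (n - 1) * (δ * (1 + δ)) := by
      have := mul_le_mul_of_nonneg_left h3 (ENNReal.toReal_nonneg (a := C))
      linarith
    have h6 : (diam A * (1 + δ)) ^ (n - 1) * (δ * (1 + δ)) =
        δ * ((1 + δ) ^ n * diam A ^ (n - 1)) := by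
      obtain ⟨m, rfl⟩ : ∃ m, n = m + 1 := ⟨n - 1, by omega⟩
      simp only [Nat.add_sub_cancel, mul_pow]; ring
    rw [div_mul_eq_mul_div, le_div_iff₀ hp]
    refine le_of_mul_le_mul_left ?_ hδ
    rw [← h6]; linarith
  rw [Measure.toSphere_apply' _ hs.measurableSet, ← hAs, ← hAdef, ← hC,
    ← ENNReal.ofReal_toReal hbdd.ediam_ne_top,
    ENNReal.ofReal_rpow_of_nonneg ENNReal.toReal_nonneg (by simpa using hn),
    ← ENNReal.ofReal_mul (by positivity), ← ENNReal.ofReal_toReal hCfin]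
  rw [show (n : ℝ) - 1 = ((n - 1 : ℕ) : ℝ) by push_cast [hn]; rfl, Real.rpow_natCast]
  rw [← ENNReal.ofReal_natCast, ← ENNReal.ofReal_mul (by positivity)]
  apply ENNReal.ofReal_le_ofReal
  simpa [diam] using h4

lemma toSphere_le_hausdorffMeasure {n : ℕ} (hn : 1 ≤ n) :
    (volume : Measure (EuclideanSpace ℝ (Fin n))).toSphere ≤ μH[(n : ℝ) - 1] := by
  have h1 : ∀ δ ∈ Ioo (0 : ℝ) 1, ∀ t,
      ENNReal.ofReal ((1 - δ) ^ (n - 1) / (1 + δ) ^ n) *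
        (volume : Measure (EuclideanSpace ℝ (Fin n))).toSphere t ≤ μH[(n : ℝ) - 1] t := by
    intro δ hδ t
    have hl : 0 < 1 - δ := by linarith [hδ.2]
    have hl' : 0 < 1 + δ := by linarith [hδ.1]
    refine Measure.le_hausdorffMeasure ((n : ℝ) - 1)
      (ENNReal.ofReal ((1 - δ) ^ (n - 1) / (1 + δ) ^ n) •
        (volume : Measure (EuclideanSpace ℝ (Fin n))).toSphere) (ENNReal.ofReal δ)
      (by simpa using hδ.1) (fun s hs => ?_) t
    have := toSphere_closed_le hn hδ.1 hδ.2 (s := closure s) isClosed_closure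
      (by rwa [Metric.ediam_closure])
    rw [Metric.ediam_closure] at this
    rw [Measure.smul_apply, smul_eq_mul]
    calc _ ≤ ENNReal.ofReal ((1 - δ) ^ (n - 1) / (1 + δ) ^ n) *
          (ENNReal.ofReal ((1 + δ) ^ n / (1 - δ) ^ (n - 1)) * Metric.ediam s ^ ((n : ℝ) - 1)) := by
          gcongr; exact (measure_mono subset_closure).trans this
      _ = Metric.ediam s ^ ((n : ℝ) - 1) := by
          rw [← mul_assoc, ← ENNReal.ofReal_mul (by positivity), div_mul_div_cancel₀ (by positivity),
            div_self (by positivity), ENNReal.ofReal_one, one_mul]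
  refine Measure.le_iff'.2 fun t => ?_
  have h2 : Filter.Tendsto (fun δ : ℝ => ENNReal.ofReal ((1 - δ) ^ (n - 1) / (1 + δ) ^ n) *
        (volume : Measure (EuclideanSpace ℝ (Fin n))).toSphere t) (𝓝[>] 0)
        (𝓝 (ENNReal.ofReal 1 *
          (volume : Measure (EuclideanSpace ℝ (Fin n))).toSphere t)) := by
    refine ENNReal.Tendsto.mul_const (ENNReal.tendsto_ofReal ?_) (Or.inl (by simp))
    have : ContinuousAt (fun δ : ℝ => (1 - δ) ^ (n - 1) / (1 + δ) ^ n) 0 := by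
      fun_prop (disch := simp)
    simpa using this.tendsto.mono_left nhdsWithin_le_nhds
  rw [ENNReal.ofReal_one, one_mul] at h2
  refine le_of_tendsto h2 ?_
  filter_upwards [Ioo_mem_nhdsGT (zero_lt_one (α := ℝ))] with δ hδ using h1 δ hδ t

lemma hausdorffMeasure_sphere_lt_top {n : ℕ} (hn : 1 ≤ n) :
    μH[(n : ℝ) - 1] (sphere (0 : EuclideanSpace ℝ (Fin n)) 1) < ⊤ := by
  have : μH[(n : ℝ) - 1] (univ : Set (sphere (0 : EuclideanSpace ℝ (Fin n)) 1)) < ⊤ := by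
    refine isCompact_univ.measure_lt_top_of_nhdsWithin fun p _ => ?_
    rw [nhdsWithin_univ]
    have hp : ‖-(p : EuclideanSpace ℝ (Fin n))‖ = 1 := by simp
    let F := (ℝ ∙ (-(p : EuclideanSpace ℝ (Fin n))))ᗮ
    have hdim : Module.finrank ℝ F = n - 1 := by
      have : Fact (Module.finrank ℝ (EuclideanSpace ℝ (Fin n)) = (n - 1) + 1) :=
        ⟨by simp; omega⟩
      exact Submodule.finrank_orthogonal_span_singleton (by intro h; simp [h] at hp)
    have hcd : ContDiff ℝ 1 (fun w : F => stereoInvFunAux (-(p : EuclideanSpace ℝ (Fin n))) w) :=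
      contDiff_stereoInvFunAux.comp F.subtypeL.contDiff
    obtain ⟨K, t, ht, hK⟩ := (hcd.contDiffAt (x := 0)).exists_lipschitzOnWith
    let T := t ∩ closedBall 0 1
    have hT : T ∈ 𝓝 (0 : F) := Filter.inter_mem ht (closedBall_mem_nhds _ one_pos)
    have hemb := isOpenEmbedding_stereographic_symm hp
    refine ⟨(stereographic hp).symm '' T, ?_, ?_⟩
    · have h0 : (stereographic hp).symm 0 = p := by
        have h : stereographic hp p = 0 := stereographic_neg_apply p
        rw [← h]
        exact (stereographic hp).left_inv (by
          rw [stereographic_source]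
          intro hc
          have := congrArg Subtype.val (mem_singleton_iff.1 hc)
          have h0 : (p : EuclideanSpace ℝ (Fin n)) = 0 := by
            ext i
            have hi : (p : EuclideanSpace ℝ (Fin n)) i = -(p : EuclideanSpace ℝ (Fin n)) i :=
              congrArg (fun q : EuclideanSpace ℝ (Fin n) => q i) this
            simp only [PiLp.zero_apply]
            linarith
          rw [h0] at hp
          simp at hp)
      have := hemb.isOpenMap.image_mem_nhds hT
      rwa [h0] at this
    · rw [← isometry_subtype_coe.hausdorffMeasure_image (Or.inl (by simpa using hn)), image_image]
      have hfin : μH[(n : ℝ) - 1] T < ⊤ := by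
        have e : (n : ℝ) - 1 = (Module.finrank ℝ F : ℝ) := by rw [hdim]; push_cast [hn]; rfl
        rw [e]
        exact (measure_mono inter_subset_right).trans_lt
          (isCompact_closedBall (0 : F) 1).measure_lt_top
      refine ((hK.mono (inter_subset_left)).hausdorffMeasure_image_le
        (by simpa using hn)).trans_lt (ENNReal.mul_lt_top ?_ hfin)
      exact ENNReal.rpow_lt_top_of_nonneg (by simpa using hn) (by simp)
  rw [← isometry_subtype_coe.hausdorffMeasure_image (Or.inl (by simpa using hn)), image_univ,
    Subtype.range_coe] at this
  exact this

lemma integral_eq_integral_Ioi_toSphere {E : Type*} [NormedAddCommGroup E] [NormedSpace ℝ E]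
    [FiniteDimensional ℝ E] [Nontrivial E] [MeasurableSpace E] [BorelSpace E]
    (μ : Measure E) [μ.IsAddHaarMeasure] {F : E → ℝ} (hF : Integrable F μ) :
    ∫ x, F x ∂μ = ∫ r in Ioi (0 : ℝ), r ^ (Module.finrank ℝ E - 1) *
      ∫ θ : sphere (0 : E) 1, F (r • (θ : E)) ∂μ.toSphere := by
  set d := Module.finrank ℝ E - 1 with hd
  let G : sphere (0 : E) 1 × Ioi (0 : ℝ) → ℝ := fun p => F (p.2.1 • (p.1 : E))
  have hG : ∀ x : ({(0)}ᶜ : Set E), G (homeomorphUnitSphereProd E x) = F x := by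
    intro x
    have hx : ‖(x : E)‖ ≠ 0 := norm_ne_zero_iff.2 x.2
    simp [G, smul_smul, hx]
  have hmp := μ.measurePreserving_homeomorphUnitSphereProd
  have hemb : MeasurableEmbedding (homeomorphUnitSphereProd E) := Homeomorph.measurableEmbedding _
  have hint : Integrable G (μ.toSphere.prod (.volumeIoiPow d)) := by
    rw [← hmp.integrable_comp_emb hemb]
    have : G ∘ homeomorphUnitSphereProd E = F ∘ (Subtype.val : ({(0)}ᶜ : Set E) → E) :=
      funext hG
    rw [this, ← integrableOn_iff_comap_subtypeVal (measurableSet_singleton _).compl]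
    exact hF.integrableOn
  calc ∫ x, F x ∂μ = ∫ x : ({(0)}ᶜ : Set E), F x ∂(μ.comap (↑)) := by
        rw [integral_subtype_comap (measurableSet_singleton _).compl F,
          restrict_compl_singleton]
    _ = ∫ p, G p ∂μ.toSphere.prod (.volumeIoiPow d) := by
        rw [← hmp.integral_comp hemb]
        exact integral_congr_ae (.of_forall fun x => (hG x).symm)
    _ = ∫ r : Ioi (0 : ℝ), ∫ θ, G (θ, r) ∂μ.toSphere ∂.volumeIoiPow d :=
        integral_prod_symm _ hint
    _ = _ := by
        simp only [Measure.volumeIoiPow, ENNReal.ofReal]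
        rw [integral_withDensity_eq_integral_smul,
          integral_subtype_comap measurableSet_Ioi fun a ↦ Real.toNNReal (a ^ d) •
            ∫ θ : sphere (0 : E) 1, F (a • (θ : E)) ∂μ.toSphere,
          setIntegral_congr_fun measurableSet_Ioi fun x hx ↦ ?_]
        · rw [NNReal.smul_def, Real.coe_toNNReal _ (pow_nonneg hx.out.le _), smul_eq_mul]
        · exact (measurable_subtype_coe.pow_const _).real_toNNReal

lemma integral_toSphere_le_integral_hausdorffMeasure {n : ℕ} (hn : 1 ≤ n) {t : ℝ} (ht : 0 < t)
    {g : EuclideanSpace ℝ (Fin n) → ℝ} (hg : Continuous g) (hg0 : ∀ x, 0 ≤ g x) :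
    t ^ (n - 1) * ∫ θ : sphere (0 : EuclideanSpace ℝ (Fin n)) 1,
        g (t • (θ : EuclideanSpace ℝ (Fin n))) ∂(volume : Measure _).toSphere ≤
      ∫ x in sphere (0 : EuclideanSpace ℝ (Fin n)) t, g x ∂(μH[(n : ℝ) - 1]) := by
  have hn' : (0 : ℝ) ≤ (n : ℝ) - 1 := by simpa using hn
  have hsph : t • sphere (0 : EuclideanSpace ℝ (Fin n)) 1 = sphere 0 t := by
    rw [smul_sphere' ht.ne']; simp [abs_of_pos ht]
  have hscale : ∀ s : Set (EuclideanSpace ℝ (Fin n)),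
      μH[(n : ℝ) - 1] (t • s) = ENNReal.ofReal (t ^ (n - 1)) * μH[(n : ℝ) - 1] s := by
    intro s
    rw [Measure.hausdorffMeasure_smul₀ hn' ht.ne', ENNReal.smul_def, smul_eq_mul,
      ENNReal.coe_rpow_of_nonneg _ hn', ← enorm_eq_nnnorm, Real.enorm_eq_ofReal ht.le,
      ENNReal.ofReal_rpow_of_pos ht]
    rw [show (n : ℝ) - 1 = ((n - 1 : ℕ) : ℝ) by push_cast [hn]; rfl, Real.rpow_natCast]
  have hfin : μH[(n : ℝ) - 1] (sphere (0 : EuclideanSpace ℝ (Fin n)) t) ≠ ⊤ := by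
    rw [← hsph, hscale]
    exact ENNReal.mul_ne_top ENNReal.ofReal_ne_top (hausdorffMeasure_sphere_lt_top hn).ne
  have hcont : Continuous fun θ : sphere (0 : EuclideanSpace ℝ (Fin n)) 1 =>
    t • (θ : EuclideanSpace ℝ (Fin n)) := by fun_prop
  let ν := Measure.map (fun θ : sphere (0 : EuclideanSpace ℝ (Fin n)) 1 =>
    t • (θ : EuclideanSpace ℝ (Fin n)))
    (ENNReal.ofReal (t ^ (n - 1)) • (volume : Measure (EuclideanSpace ℝ (Fin n))).toSphere)
  have hν : ∫ x, g x ∂ν = t ^ (n - 1) * ∫ θ : sphere (0 : EuclideanSpace ℝ (Fin n)) 1,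
        g (t • (θ : EuclideanSpace ℝ (Fin n))) ∂(volume : Measure _).toSphere := by
    rw [integral_map hcont.aemeasurable hg.aestronglyMeasurable, integral_smul_measure,
      ENNReal.toReal_ofReal (by positivity), smul_eq_mul]
  have hle : ν ≤ (μH[(n : ℝ) - 1]).restrict (sphere (0 : EuclideanSpace ℝ (Fin n)) t) := by
    refine Measure.le_iff.2 fun s hs => ?_
    rw [Measure.map_apply hcont.measurable hs, Measure.smul_apply, smul_eq_mul,
      Measure.restrict_apply hs]
    calc _ ≤ ENNReal.ofReal (t ^ (n - 1)) * μH[(n : ℝ) - 1]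
          ((fun θ : sphere (0 : EuclideanSpace ℝ (Fin n)) 1 =>
            t • (θ : EuclideanSpace ℝ (Fin n))) ⁻¹' s) := by
          gcongr; exact toSphere_le_hausdorffMeasure hn
      _ = μH[(n : ℝ) - 1] (t • (Subtype.val '' ((fun θ : sphere (0 : EuclideanSpace ℝ (Fin n)) 1 =>
            t • (θ : EuclideanSpace ℝ (Fin n))) ⁻¹' s))) := by
          rw [hscale, isometry_subtype_coe.hausdorffMeasure_image (Or.inl hn')]
      _ ≤ _ := by
          refine measure_mono ?_
          rintro _ ⟨_, ⟨θ, hθ, rfl⟩, rfl⟩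
          exact ⟨hθ, hsph ▸ smul_mem_smul_set θ.2⟩
  rw [← hν]
  refine integral_mono_measure hle (.of_forall hg0) ?_
  obtain ⟨M, hM⟩ := (isCompact_sphere (0 : EuclideanSpace ℝ (Fin n)) t).exists_bound_of_continuousOn
    hg.continuousOn
  exact Measure.integrableOn_of_bounded hfin hg.aestronglyMeasurable (M := M)
    ((ae_restrict_iff' isClosed_sphere.measurableSet).2 (.of_forall hM))

end

/-- The determinant as a continuous alternating map of the rows. -/
noncomputable def detRows (n : ℕ) : (Fin n → ℝ) [⋀^Fin n]→L[ℝ] ℝ where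
  toAlternatingMap := Matrix.detRowAlternating
  cont := (continuous_id (X := Matrix (Fin n) (Fin n) ℝ)).matrix_det

lemma sum_detRows_update_update_eq_zero {n : ℕ} (m : Fin n → Fin n → ℝ) {i k : Fin n}
    (hik : k ≠ i) (H : Fin n → Fin n → ℝ) (hH : ∀ j l, H j l = H l j) :
    ∑ j, detRows n (Function.update (Function.update m i (Pi.single j 1)) k (H j)) = 0 := by
  let a : Fin n → Fin n → ℝ := fun j l =>
    detRows n (Function.update (Function.update m i (Pi.single j 1)) k (Pi.single l 1))
  have ha : ∀ j l, a l j = -a j l := by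
    intro j l
    refine Eq.trans ?_ ((detRows n).toAlternatingMap.map_swap _ hik.symm)
    change detRows n _ = detRows n _
    congr 1
    funext p
    simp only [Function.comp_apply]
    by_cases h1 : p = i
    · subst h1; simp [Function.update_of_ne hik.symm]
    · by_cases h2 : p = k
      · subst h2; simp [Function.update_of_ne hik.symm]
      · simp [Equiv.swap_apply_of_ne_of_ne h1 h2, h1, h2]
  have hexp : ∀ j, detRows n (Function.update (Function.update m i (Pi.single j 1)) k (H j)) =
      ∑ l, H j l * a j l := by
    intro j
    conv_lhs => rw [pi_eq_sum_univ' (H j)]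
    have := (detRows n).toMultilinearMap.map_update_sum Finset.univ k
      (fun l => H j l • (Pi.single l 1 : Fin n → ℝ)) (Function.update m i (Pi.single j 1))
    refine Eq.trans ?_ (this.trans (Finset.sum_congr rfl fun l _ => ?_))
    · congr 2
    · exact (detRows n).map_update_smul _ _ _ _
  simp_rw [hexp]
  have : ∑ j, ∑ l, H j l * a j l = -∑ j, ∑ l, H j l * a j l := by
    conv_lhs => rw [Finset.sum_comm]
    rw [← Finset.sum_neg_distrib]
    refine Finset.sum_congr rfl fun j _ => ?_
    rw [← Finset.sum_neg_distrib]
    refine Finset.sum_congr rfl fun l _ => ?_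
    rw [ha, hH]; ring
  linarith

lemma cofMatrix_apply {n : ℕ} (A : Matrix (Fin n) (Fin n) ℝ) (i j : Fin n) :
    cofMatrix A i j = detRows n (Function.update (fun k => A k) i (Pi.single j 1)) := by
  rw [cofMatrix, Matrix.transpose_apply, Matrix.adjugate_apply]
  rfl

lemma hasFDerivAt_detRows_update {n : ℕ} {E : Type*} [NormedAddCommGroup E] [NormedSpace ℝ E]
    {m : E → Fin n → Fin n → ℝ} {m' : Fin n → (E →L[ℝ] (Fin n → ℝ))} {x : E}
    (hm : ∀ k, HasFDerivAt (fun y => m y k) (m' k) x) (i : Fin n) (c : Fin n → ℝ) :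
    ∃ L : E →L[ℝ] ℝ, HasFDerivAt (fun y => detRows n (Function.update (m y) i c)) L x ∧
      ∀ v, L v = ∑ k ∈ Finset.univ.erase i,
        detRows n (Function.update (Function.update (m x) i c) k (m' k v)) := by
  have h1 : HasFDerivAt (fun y => Function.update (m y) i c)
      (ContinuousLinearMap.pi fun k => if k = i then 0 else m' k) x := by
    rw [hasFDerivAt_pi]
    intro k
    by_cases hk : k = i
    · subst hk
      simpa using hasFDerivAt_const (𝕜 := ℝ) c x
    · simpa [hk] using hm k
  refine ⟨_, ((detRows n).hasFDerivAt _).comp x h1, fun v => ?_⟩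
  rw [ContinuousLinearMap.comp_apply, ContinuousMultilinearMap.linearDeriv_apply,
    ← Finset.add_sum_erase _ _ (Finset.mem_univ i)]
  have h0 : (detRows n).1 (Function.update (Function.update (m x) i c) i
      ((ContinuousLinearMap.pi fun k => if k = i then 0 else m' k) v i)) = 0 := by
    refine (detRows n).toMultilinearMap.map_coord_zero i ?_
    simp
  rw [h0, zero_add]
  refine Finset.sum_congr rfl fun k hk => ?_
  have hk := Finset.ne_of_mem_erase hk
  simp only [ContinuousLinearMap.pi_apply, if_neg hk]
  rfl

lemma hasFDerivAt_jacobianMatrix_row {n : ℕ}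
    {f : EuclideanSpace ℝ (Fin n) → EuclideanSpace ℝ (Fin n)} (hf : ContDiff ℝ 2 f) (k : Fin n)
    (x : EuclideanSpace ℝ (Fin n)) :
    ∃ L : EuclideanSpace ℝ (Fin n) →L[ℝ] (Fin n → ℝ),
      HasFDerivAt (fun y => jacobianMatrix f y k) L x ∧
      ∀ v l, L v l = fderiv ℝ (fderiv ℝ f) x v (EuclideanSpace.single l 1) k := by
  have h : DifferentiableAt ℝ (fderiv ℝ f) x :=
    ((hf.fderiv_right (m := 1) (by norm_num)).differentiable (by norm_num)) x
  refine ⟨ContinuousLinearMap.pi fun l => (EuclideanSpace.proj k).comp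
    ((ContinuousLinearMap.apply ℝ _ (EuclideanSpace.single l 1)).comp (fderiv ℝ (fderiv ℝ f) x)),
    ?_, fun v l => rfl⟩
  rw [hasFDerivAt_pi]
  intro l
  exact ((EuclideanSpace.proj k).hasFDerivAt).comp x
    ((ContinuousLinearMap.apply ℝ _ (EuclideanSpace.single l (1 : ℝ))).hasFDerivAt.comp x
      h.hasFDerivAt)

/-- Piola identity: the rows of the cofactor matrix of a differential are divergence free. -/
lemma sum_fderiv_cofMatrix_jacobianMatrix {n : ℕ}
    {f : EuclideanSpace ℝ (Fin n) → EuclideanSpace ℝ (Fin n)} (hf : ContDiff ℝ 2 f) (i : Fin n)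
    (x : EuclideanSpace ℝ (Fin n)) :
    ∑ j, fderiv ℝ (fun y => cofMatrix (jacobianMatrix f y) i j) x (EuclideanSpace.single j 1) = 0 := by
  choose L hL hL' using fun k => hasFDerivAt_jacobianMatrix_row hf k x
  choose P hP hP' using fun j : Fin n => hasFDerivAt_detRows_update hL i (Pi.single j 1)
  simp only [cofMatrix_apply]
  simp_rw [(hP _).fderiv, hP']
  rw [Finset.sum_comm]
  refine Finset.sum_eq_zero fun k hk => ?_
  refine sum_detRows_update_update_eq_zero _ (Finset.ne_of_mem_erase hk)
    (fun j => L k (EuclideanSpace.single j 1)) fun j l => ?_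
  rw [hL', hL']
  have := (hf.contDiffAt (x := x)).isSymmSndFDerivAt (by simp)
  rw [this.eq]

lemma contDiff_cofMatrix_jacobianMatrix {n : ℕ}
    {f : EuclideanSpace ℝ (Fin n) → EuclideanSpace ℝ (Fin n)} (hf : ContDiff ℝ 2 f) (i j : Fin n) :
    ContDiff ℝ 1 fun y => cofMatrix (jacobianMatrix f y) i j := by
  have h : ContDiff ℝ 1 (fderiv ℝ f) := hf.fderiv_right (by norm_num)
  simp only [cofMatrix_apply]
  refine (detRows n).1.contDiff.comp
    (f := fun y => Function.update (fun k => jacobianMatrix f y k) i (Pi.single j 1)) ?_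
  rw [contDiff_pi]
  intro k
  by_cases hk : k = i
  · subst hk; simpa using contDiff_const
  · simp only [Function.update_of_ne hk]
    rw [contDiff_pi]
    intro l
    exact (EuclideanSpace.proj k).contDiff.comp (h.clm_apply contDiff_const)

section

variable {n : ℕ} {f : EuclideanSpace ℝ (Fin n) → EuclideanSpace ℝ (Fin n)} {Ψ : ℝ → ℝ}

/-- The vector field `Ψ(|f|²) (cof Df)ᵀ f`. -/
noncomputable def cofField (f : EuclideanSpace ℝ (Fin n) → EuclideanSpace ℝ (Fin n)) (Ψ : ℝ → ℝ)
    (j : Fin n) (x : EuclideanSpace ℝ (Fin n)) : ℝ :=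
  ∑ i, Ψ (‖f x‖ ^ 2) * f x i * cofMatrix (jacobianMatrix f x) i j

lemma contDiff_comp_norm_sq (hf : ContDiff ℝ 2 f) (hΨ : ContDiffOn ℝ 1 Ψ (Ici 0)) :
    ContDiff ℝ 1 fun x => Ψ (‖f x‖ ^ 2) := by
  have h : ContDiff ℝ 1 fun x => ‖f x‖ ^ 2 := (hf.of_le (by norm_num)).norm_sq ℝ
  rw [← contDiffOn_univ]
  exact hΨ.comp h.contDiffOn fun x _ => mem_Ici.2 (sq_nonneg _)

lemma contDiff_euclidean_apply (hf : ContDiff ℝ 2 f) (i : Fin n) :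
    ContDiff ℝ 1 fun x => f x i :=
  (EuclideanSpace.proj i : EuclideanSpace ℝ (Fin n) →L[ℝ] ℝ).contDiff.comp
    (hf.of_le (m := 1) (by norm_num))

lemma contDiff_cofField (hf : ContDiff ℝ 2 f) (hΨ : ContDiffOn ℝ 1 Ψ (Ici 0)) (j : Fin n) :
    ContDiff ℝ 1 (cofField f Ψ j) := by
  refine ContDiff.sum fun i _ => ?_
  exact ((contDiff_comp_norm_sq hf hΨ).mul (contDiff_euclidean_apply hf i)).mul
    (contDiff_cofMatrix_jacobianMatrix hf i j)

lemma fderiv_comp_norm_sq_mul (hf : ContDiff ℝ 2 f) (hΨ : ContDiffOn ℝ 1 Ψ (Ici 0))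
    (i j : Fin n) (x : EuclideanSpace ℝ (Fin n)) :
    fderiv ℝ (fun y => Ψ (‖f y‖ ^ 2) * f y i) x (EuclideanSpace.single j 1) =
      ∑ k, (Ψ (‖f x‖ ^ 2) * (1 : Matrix (Fin n) (Fin n) ℝ) i k +
        2 * derivWithin Ψ (Ici 0) (‖f x‖ ^ 2) * (f x i * f x k)) * jacobianMatrix f x k j := by
  have hfx : HasFDerivAt f (fderiv ℝ f x) x := (hf.differentiable (by norm_num) x).hasFDerivAt
  have h1 := hfx.norm_sq
  have h2 : HasDerivWithinAt Ψ (derivWithin Ψ (Ici 0) (‖f x‖ ^ 2)) (Ici 0) (‖f x‖ ^ 2) :=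
    ((hΨ.differentiableOn (by norm_num)) _ (mem_Ici.2 (sq_nonneg _))).hasDerivWithinAt
  have h3 := h2.comp_hasFDerivAt x h1 (.of_forall fun y => mem_Ici.2 (sq_nonneg ‖f y‖))
  have h4 : HasFDerivAt (fun y => f y i)
      ((EuclideanSpace.proj i : EuclideanSpace ℝ (Fin n) →L[ℝ] ℝ).comp (fderiv ℝ f x)) x :=
    (EuclideanSpace.proj i : EuclideanSpace ℝ (Fin n) →L[ℝ] ℝ).hasFDerivAt.comp x hfx
  have h5 := (h3.mul h4).fderiv
  change fderiv ℝ ((Ψ ∘ fun y => ‖f y‖ ^ 2) * fun y => f y i) x _ = _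
  rw [h5]
  have h6 : inner ℝ (f x) (fderiv ℝ f x (EuclideanSpace.single j 1)) =
      ∑ k, f x k * jacobianMatrix f x k j := by
    rw [PiLp.inner_apply]
    exact Finset.sum_congr rfl fun k _ => by simp [jacobianMatrix, mul_comm]
  have h7 : ∑ k, Ψ (‖f x‖ ^ 2) * (1 : Matrix (Fin n) (Fin n) ℝ) i k * jacobianMatrix f x k j =
      Ψ (‖f x‖ ^ 2) * jacobianMatrix f x i j := by
    simp [Matrix.one_apply]
  simp_rw [add_mul]
  rw [Finset.sum_add_distrib, h7]
  simp only [add_apply, smul_apply, smul_eq_mul,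
    ContinuousLinearMap.comp_apply, innerSL_apply_apply, h6]
  congr 1
  simp only [nsmul_eq_mul, Finset.mul_sum, Nat.cast_ofNat]
  exact Finset.sum_congr rfl fun k _ => by ring

lemma sum_fderiv_cofField (hf : ContDiff ℝ 2 f) (hΨ : ContDiffOn ℝ 1 Ψ (Ici 0))
    (x : EuclideanSpace ℝ (Fin n)) :
    ∑ j, fderiv ℝ (cofField f Ψ j) x (EuclideanSpace.single j 1) =
      ((n : ℝ) * Ψ (‖f x‖ ^ 2) + 2 * ‖f x‖ ^ 2 * derivWithin Ψ (Ici 0) (‖f x‖ ^ 2)) *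
        (jacobianMatrix f x).det := by
  have hg : ∀ i, DifferentiableAt ℝ (fun y => Ψ (‖f y‖ ^ 2) * f y i) x := fun i =>
    ((contDiff_comp_norm_sq hf hΨ).mul (contDiff_euclidean_apply hf i)).differentiable
      (by norm_num) x
  have hc : ∀ i j, DifferentiableAt ℝ (fun y => cofMatrix (jacobianMatrix f y) i j) x :=
    fun i j => (contDiff_cofMatrix_jacobianMatrix hf i j).differentiable (by norm_num) x
  have h1 : ∀ j, fderiv ℝ (cofField f Ψ j) x (EuclideanSpace.single j 1) =
      ∑ i, (Ψ (‖f x‖ ^ 2) * f x i * fderiv ℝ (fun y => cofMatrix (jacobianMatrix f y) i j) x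
          (EuclideanSpace.single j 1) +
        cofMatrix (jacobianMatrix f x) i j *
          fderiv ℝ (fun y => Ψ (‖f y‖ ^ 2) * f y i) x (EuclideanSpace.single j 1)) := by
    intro j
    have := (HasFDerivAt.fun_sum (u := Finset.univ) fun i _ =>
      ((hg i).hasFDerivAt.mul (hc i j).hasFDerivAt)).fderiv
    change fderiv ℝ (fun y => ∑ i, _) x _ = _
    erw [this]
    simp
  simp_rw [h1]
  rw [Finset.sum_comm]
  simp_rw [Finset.sum_add_distrib, ← Finset.mul_sum, sum_fderiv_cofMatrix_jacobianMatrix hf,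
    mul_zero, Finset.sum_const_zero, zero_add, fderiv_comp_norm_sq_mul hf hΨ]
  set B : Matrix (Fin n) (Fin n) ℝ := Matrix.of fun i k =>
    Ψ (‖f x‖ ^ 2) * (1 : Matrix (Fin n) (Fin n) ℝ) i k +
        2 * derivWithin Ψ (Ici 0) (‖f x‖ ^ 2) * (f x i * f x k) with hB
  have h2 : ∑ i, ∑ j, cofMatrix (jacobianMatrix f x) i j * ∑ k, B i k * jacobianMatrix f x k j =
      (B * jacobianMatrix f x * (jacobianMatrix f x).adjugate).trace := by
    rw [Matrix.trace]
    refine Finset.sum_congr rfl fun i _ => ?_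
    rw [Matrix.diag_apply, Matrix.mul_apply]
    exact Finset.sum_congr rfl fun j _ => by
      rw [cofMatrix, Matrix.transpose_apply, Matrix.mul_apply, mul_comm]
  have h3 : B.trace = n * Ψ (‖f x‖ ^ 2) + 2 * ‖f x‖ ^ 2 * derivWithin Ψ (Ici 0) (‖f x‖ ^ 2) := by
    have hs : ∑ k, f x k ^ 2 = ‖f x‖ ^ 2 := (EuclideanSpace.real_norm_sq_eq _).symm
    rw [Matrix.trace]
    simp only [hB, Matrix.diag_apply, Matrix.of_apply, Matrix.one_apply_eq, mul_one,
      Finset.sum_add_distrib, Finset.sum_const, Finset.card_univ, Fintype.card_fin, nsmul_eq_mul,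
      ← Finset.mul_sum, ← sq, hs]
    ring
  refine h2.trans ?_
  rw [mul_assoc, Matrix.mul_adjugate, Matrix.mul_smul, mul_one, Matrix.trace_smul, h3, smul_eq_mul,
    mul_comm]

lemma abs_sum_mul_cofField_le (hΨ0 : ∀ s ∈ Ici (0 : ℝ), 0 ≤ Ψ s)
    (v x : EuclideanSpace ℝ (Fin n)) :
    |∑ j, v j * cofField f Ψ j x| ≤
      ‖v‖ * (‖f x‖ * Ψ (‖f x‖ ^ 2) * matOpNorm (cofMatrix (jacobianMatrix f x))) := by
  set C := cofMatrix (jacobianMatrix f x)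
  let T := LinearMap.toContinuousLinearMap (Matrix.toEuclideanLin C)
  have h1 : ∑ j, v j * cofField f Ψ j x = Ψ (‖f x‖ ^ 2) * inner ℝ (f x) (T v) := by
    have hT : ∀ i, T v i = ∑ j, C i j * v j := fun i => by
      simp [T, Matrix.toLpLin_apply, Matrix.mulVec, dotProduct]
    simp only [cofField, PiLp.inner_apply, hT, Finset.mul_sum]
    rw [Finset.sum_comm]
    simp only [RCLike.inner_apply, conj_trivial, Finset.sum_mul, Finset.mul_sum]
    exact Finset.sum_congr rfl fun i _ => Finset.sum_congr rfl fun j _ => by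
      simp only [C]; ring
  have h2 := hΨ0 (‖f x‖ ^ 2) (mem_Ici.2 (sq_nonneg _))
  rw [h1, abs_mul, abs_of_nonneg h2]
  calc _ ≤ Ψ (‖f x‖ ^ 2) * (‖f x‖ * (‖T‖ * ‖v‖)) := by
        gcongr
        exact (abs_real_inner_le_norm _ _).trans (by gcongr; exact T.le_opNorm v)
    _ = _ := by rw [matOpNorm]; ring

lemma continuous_cofMatrix_norm (hf : ContDiff ℝ 2 f) (hΨ : ContDiffOn ℝ 1 Ψ (Ici 0)) :
    Continuous fun x =>
      ‖f x‖ * Ψ (‖f x‖ ^ 2) * matOpNorm (cofMatrix (jacobianMatrix f x)) := by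
  refine (hf.continuous.norm.mul (contDiff_comp_norm_sq hf hΨ).continuous).mul ?_
  have h1 : Continuous fun x => cofMatrix (jacobianMatrix f x) :=
    continuous_matrix fun i j => (contDiff_cofMatrix_jacobianMatrix hf i j).continuous
  exact (((LinearMap.continuous_of_finiteDimensional
    ((LinearMap.toContinuousLinearMap :
      (EuclideanSpace ℝ (Fin n) →ₗ[ℝ] EuclideanSpace ℝ (Fin n)) ≃ₗ[ℝ] _).toLinearMap ∘ₗ
      (Matrix.toEuclideanLin : Matrix (Fin n) (Fin n) ℝ ≃ₗ[ℝ] _).toLinearMap)).comp h1).norm)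

lemma abs_integral_cutoff_le (hf : ContDiff ℝ 2 f) (hΨ : ContDiffOn ℝ 1 Ψ (Ici 0))
    (hΨ0 : ∀ s ∈ Ici (0 : ℝ), 0 ≤ Ψ s) {φ : ℝ → ℝ} (hφ : ContDiff ℝ 1 φ) {t : ℝ} (ht : 0 ≤ t)
    (hφt : ∀ s, t ^ 2 ≤ s → φ s = 0) :
    |∫ x, φ (‖x‖ ^ 2) *
      (((n : ℝ) * Ψ (‖f x‖ ^ 2) + 2 * ‖f x‖ ^ 2 * derivWithin Ψ (Ici 0) (‖f x‖ ^ 2)) *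
        (jacobianMatrix f x).det)| ≤
    ∫ x, |2 * deriv φ (‖x‖ ^ 2)| * ‖x‖ *
      (‖f x‖ * Ψ (‖f x‖ ^ 2) * matOpNorm (cofMatrix (jacobianMatrix f x))) := by
  let η : EuclideanSpace ℝ (Fin n) → ℝ := fun x => φ (‖x‖ ^ 2)
  have hη : ContDiff ℝ 1 η := hφ.comp (contDiff_id.norm_sq ℝ)
  have hηc : HasCompactSupport η := by
    refine HasCompactSupport.intro (isCompact_closedBall 0 t) fun x hx => hφt _ ?_
    have : t < ‖x‖ := by simpa using hx
    gcongr
  have hη' : ∀ x v, fderiv ℝ η x v = 2 * deriv φ (‖x‖ ^ 2) * inner ℝ x v := by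
    intro x v
    have h1 : HasFDerivAt (fun y : EuclideanSpace ℝ (Fin n) => ‖y‖ ^ 2) _ x :=
      (hasFDerivAt_id x).norm_sq
    have h2 := ((hφ.differentiable (by norm_num) (‖x‖ ^ 2)).hasDerivAt.comp_hasFDerivAt x h1).fderiv
    rw [show fderiv ℝ η x = _ from h2]
    simp
    ring
  have hdφ : Continuous (deriv φ) := hφ.continuous_deriv (by norm_num)
  have hW := fun j => contDiff_cofField hf hΨ j
  have hWd : ∀ j, Continuous fun x => fderiv ℝ (cofField f Ψ j) x (EuclideanSpace.single j 1) :=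
    fun j => ((hW j).continuous_fderiv (by norm_num)).clm_apply continuous_const
  have hηd : ∀ j, Continuous fun x => fderiv ℝ η x (EuclideanSpace.single j 1) :=
    fun j => (hη.continuous_fderiv (by norm_num)).clm_apply continuous_const
  have hηdc : ∀ j, HasCompactSupport fun x => fderiv ℝ η x (EuclideanSpace.single j 1) :=
    fun j => hηc.fderiv_apply ℝ _
  have i1 : ∀ j, Integrable fun x => η x * fderiv ℝ (cofField f Ψ j) x (EuclideanSpace.single j 1) :=
    fun j => (hη.continuous.mul (hWd j)).integrable_of_hasCompactSupport hηc.mul_right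
  have i2 : ∀ j, Integrable fun x => fderiv ℝ η x (EuclideanSpace.single j 1) * cofField f Ψ j x :=
    fun j => ((hηd j).mul (hW j).continuous).integrable_of_hasCompactSupport (hηdc j).mul_right
  have i3 : ∀ j, Integrable fun x => η x * cofField f Ψ j x :=
    fun j => (hη.continuous.mul (hW j).continuous).integrable_of_hasCompactSupport hηc.mul_right
  have hparts : ∫ x, η x * (((n : ℝ) * Ψ (‖f x‖ ^ 2) +
        2 * ‖f x‖ ^ 2 * derivWithin Ψ (Ici 0) (‖f x‖ ^ 2)) * (jacobianMatrix f x).det) =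
      -∫ x, ∑ j, fderiv ℝ η x (EuclideanSpace.single j 1) * cofField f Ψ j x := by
    simp_rw [← sum_fderiv_cofField hf hΨ, Finset.mul_sum]
    rw [integral_finsetSum _ fun j _ => i1 j, integral_finsetSum _ fun j _ => i2 j,
      ← Finset.sum_neg_distrib]
    exact Finset.sum_congr rfl fun j _ => integral_mul_fderiv_eq_neg_fderiv_mul_of_integrable
      (i2 j) (i1 j) (i3 j) (fun x _ => hη.differentiable (by norm_num) x)
      (fun x _ => (hW j).differentiable (by norm_num) x)
  change |∫ x, η x * _| ≤ _
  rw [hparts, abs_neg]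
  refine abs_integral_le_integral_abs.trans (integral_mono_of_nonneg (.of_forall fun _ => abs_nonneg _)
    ?_ (.of_forall fun x => ?_))
  · refine Continuous.integrable_of_hasCompactSupport ?_ ?_
    · have := continuous_cofMatrix_norm hf hΨ
      fun_prop
    · refine HasCompactSupport.intro (isCompact_closedBall 0 t) fun x hx => ?_
      have hx : t < ‖x‖ := by simpa using hx
      have : deriv φ (‖x‖ ^ 2) = 0 := by
        have : φ =ᶠ[𝓝 (‖x‖ ^ 2)] fun _ => 0 := by
          filter_upwards [Ioi_mem_nhds (show t ^ 2 < ‖x‖ ^ 2 by gcongr)] with s hs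
          exact hφt s hs.le
        rw [this.deriv_eq]; simp
      simp [this]
  · have h := abs_sum_mul_cofField_le (f := f) hΨ0 ((2 * deriv φ (‖x‖ ^ 2)) • x) x
    rw [norm_smul, Real.norm_eq_abs] at h
    simpa [hη', EuclideanSpace.inner_single_right] using h

end

section

open Filter

lemma integral_Ioi_abs_deriv_sq_mul_le {φ b : ℝ → ℝ} (hφ : ContDiff ℝ 1 φ) (hanti : Antitone φ)
    {a t M : ℝ} (ht : 0 ≤ t) (h1 : ∀ s ≤ a ^ 2, φ s = 1) (h0 : ∀ s, t ^ 2 ≤ s → φ s = 0)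
    (hb0 : ∀ r, 0 < r → 0 ≤ b r) (hM : 0 ≤ M) (hb : ∀ r ∈ Icc a t, b r ≤ M) :
    ∫ r in Ioi 0, |2 * deriv φ (r ^ 2)| * r * b r ≤ M := by
  have hd : ∀ s, deriv φ s ≤ 0 := fun s => hanti.deriv_nonpos
  have hpos : ∀ r ∈ Ioi (0 : ℝ), 0 ≤ -(M * (deriv φ (r ^ 2) * (2 * r))) := fun r hr => by
    have := mul_nonneg hM (mul_nonneg (neg_nonneg.2 (hd (r ^ 2))) (mul_nonneg zero_le_two hr.le))
    linarith
  have hderiv : ∀ r ∈ Ioi (0 : ℝ), HasDerivAt (fun r => -(M * φ (r ^ 2)))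
      (-(M * (deriv φ (r ^ 2) * (2 * r)))) r := fun r _ => by
    have h := ((hφ.differentiable (by norm_num) (r ^ 2)).hasDerivAt.comp r (hasDerivAt_pow 2 r))
    simpa [Function.comp_def] using (h.const_mul M).fun_neg
  have hcont : ContinuousWithinAt (fun r => -(M * φ (r ^ 2))) (Ici 0) 0 := by
    have := hφ.continuous
    exact (by fun_prop : Continuous fun r => -(M * φ (r ^ 2))).continuousWithinAt
  have hlim : Tendsto (fun r => -(M * φ (r ^ 2))) atTop (𝓝 0) := by
    refine tendsto_const_nhds.congr' ?_
    filter_upwards [eventually_ge_atTop |t|] with r hr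
    have : t ^ 2 ≤ r ^ 2 := by rw [← sq_abs t]; gcongr
    simp [h0 _ this]
  have hint := integrableOn_Ioi_deriv_of_nonneg hcont hderiv hpos hlim
  calc ∫ r in Ioi 0, |2 * deriv φ (r ^ 2)| * r * b r
      ≤ ∫ r in Ioi 0, -(M * (deriv φ (r ^ 2) * (2 * r))) := by
        refine integral_mono_of_nonneg ?_ hint ?_
        · filter_upwards [ae_restrict_mem measurableSet_Ioi] with r hr
          exact mul_nonneg (mul_nonneg (abs_nonneg _) (le_of_lt hr)) (hb0 r hr)
        · filter_upwards [ae_restrict_mem measurableSet_Ioi] with r (hr : 0 < r)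
          by_cases hrI : r ∈ Icc a t
          · rw [abs_of_nonpos (by linarith [hd (r ^ 2)])]
            have : 0 ≤ -(2 * deriv φ (r ^ 2)) * r :=
              mul_nonneg (by linarith [hd (r ^ 2)]) hr.le
            nlinarith [mul_le_mul_of_nonneg_left (hb r hrI) this]
          · have h : deriv φ (r ^ 2) = 0 := by
              rcases lt_or_ge r a with hra | har
              · have : φ =ᶠ[𝓝 (r ^ 2)] fun _ => 1 := by
                  filter_upwards [Iio_mem_nhds (show r ^ 2 < a ^ 2 by gcongr)] with s hs
                  exact h1 s hs.le
                rw [this.deriv_eq, deriv_const]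
              · have htr : t < r := not_le.1 fun h => hrI ⟨har, h⟩
                have : φ =ᶠ[𝓝 (r ^ 2)] fun _ => 0 := by
                  filter_upwards [Ioi_mem_nhds (show t ^ 2 < r ^ 2 by gcongr)] with s hs
                  exact h0 s hs.le
                rw [this.deriv_eq, deriv_const]
            simp [h]
    _ = M := by
        rw [integral_Ioi_of_hasDerivAt_of_nonneg hcont hderiv hpos hlim]
        simp [h1 0 (sq_nonneg a)]

variable {n : ℕ} {f : EuclideanSpace ℝ (Fin n) → EuclideanSpace ℝ (Fin n)} {Ψ : ℝ → ℝ}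

lemma abs_setIntegral_ball_le_integral_sphere (hn : 1 ≤ n) (hf : ContDiff ℝ 2 f)
    (hΨ : ContDiffOn ℝ 1 Ψ (Ici 0)) (hΨ0 : ∀ s ∈ Ici (0 : ℝ), 0 ≤ Ψ s) {t : ℝ} (ht : 0 < t) :
    |∫ x in ball (0 : EuclideanSpace ℝ (Fin n)) t,
      ((n : ℝ) * Ψ (‖f x‖ ^ 2) + 2 * ‖f x‖ ^ 2 * derivWithin Ψ (Ici 0) (‖f x‖ ^ 2)) *
        (jacobianMatrix f x).det| ≤
    ∫ x in sphere (0 : EuclideanSpace ℝ (Fin n)) t,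
      ‖f x‖ * Ψ (‖f x‖ ^ 2) * matOpNorm (cofMatrix (jacobianMatrix f x)) ∂μH[(n : ℝ) - 1] := by
  have : Nonempty (Fin n) := ⟨⟨0, hn⟩⟩
  have : Nontrivial (EuclideanSpace ℝ (Fin n)) := inferInstance
  set D : EuclideanSpace ℝ (Fin n) → ℝ := fun x =>
    ((n : ℝ) * Ψ (‖f x‖ ^ 2) + 2 * ‖f x‖ ^ 2 * derivWithin Ψ (Ici 0) (‖f x‖ ^ 2)) *
        (jacobianMatrix f x).det with hD
  set G : EuclideanSpace ℝ (Fin n) → ℝ := fun x =>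
    ‖f x‖ * Ψ (‖f x‖ ^ 2) * matOpNorm (cofMatrix (jacobianMatrix f x)) with hG
  have hGc : Continuous G := continuous_cofMatrix_norm hf hΨ
  have hG0 : ∀ x, 0 ≤ G x := fun x =>
    mul_nonneg (mul_nonneg (norm_nonneg _) (hΨ0 _ (mem_Ici.2 (sq_nonneg _)))) (norm_nonneg _)
  have hDc : Continuous D := by
    simp_rw [hD, ← sum_fderiv_cofField hf hΨ]
    exact continuous_finsetSum _ fun j _ =>
      ((contDiff_cofField hf hΨ j).continuous_fderiv (by norm_num)).clm_apply continuous_const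
  let σ := (volume : Measure (EuclideanSpace ℝ (Fin n))).toSphere
  let b : ℝ → ℝ := fun r => r ^ (n - 1) * ∫ θ : sphere (0 : EuclideanSpace ℝ (Fin n)) 1,
    G (r • (θ : EuclideanSpace ℝ (Fin n))) ∂σ
  have hb0 : ∀ r, 0 < r → 0 ≤ b r := fun r hr =>
    mul_nonneg (pow_nonneg hr.le _) (integral_nonneg fun _ => hG0 _)
  have hbc : Continuous b := by
    refine (continuous_pow _).mul ?_
    have := continuous_parametric_integral_of_continuous (μ := σ)
      (f := fun (r : ℝ) (θ : sphere (0 : EuclideanSpace ℝ (Fin n)) 1) =>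
        G (r • (θ : EuclideanSpace ℝ (Fin n)))) (by unfold Function.uncurry; fun_prop)
      isCompact_univ
    simpa using this
  refine le_trans ?_ (integral_toSphere_le_integral_hausdorffMeasure hn ht hGc hG0)
  change _ ≤ b t
  refine le_of_forall_gt_imp_ge_of_dense fun M hM => ?_
  have hM0 : 0 ≤ M := (hb0 t ht).trans hM.le
  obtain ⟨a, hat, ha⟩ : ∃ a, a < t ∧ ∀ r ∈ Icc a t, b r ≤ M := by
    have h := hbc.continuousAt.eventually_le_const hM
    obtain ⟨δ, hδ, h⟩ := Metric.eventually_nhds_iff_ball.1 h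
    refine ⟨t - δ / 2, by linarith, fun r hr => h r ?_⟩
    rw [Real.ball_eq_Ioo]
    exact ⟨by linarith [hr.1], by linarith [hr.2]⟩
  let φ : ℕ → ℝ → ℝ := fun k s => Real.smoothTransition (k * (t ^ 2 - s))
  have hφ : ∀ k, ContDiff ℝ 1 (φ k) := fun k =>
    (Real.smoothTransition.contDiff (n := 1)).comp (by fun_prop)
  have hφt : ∀ k s, t ^ 2 ≤ s → φ k s = 0 := fun k s hs =>
    Real.smoothTransition.zero_of_nonpos
      (mul_nonpos_of_nonneg_of_nonpos k.cast_nonneg (by linarith))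
  have hφanti : ∀ k, Antitone (φ k) := fun k s s' hs =>
    Real.smoothTransition.monotone (by gcongr)
  have hφ1 : ∀ s, s < t ^ 2 → ∀ᶠ k in atTop, φ k s = 1 := fun s hs => by
    have hs : 0 < t ^ 2 - s := by linarith
    filter_upwards [(tendsto_natCast_atTop_atTop (R := ℝ)).atTop_mul_const hs |>.eventually_ge_atTop 1]
      with k hk
    exact Real.smoothTransition.one_of_one_le hk
  have hlim : Tendsto (fun k => ∫ x, φ k (‖x‖ ^ 2) * D x) atTop
      (𝓝 (∫ x in ball (0 : EuclideanSpace ℝ (Fin n)) t, D x)) := by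
    rw [← integral_indicator measurableSet_ball]
    refine tendsto_integral_of_dominated_convergence
      ((closedBall (0 : EuclideanSpace ℝ (Fin n)) t).indicator fun x => |D x|) (fun k => ?_) ?_
      (fun k => .of_forall fun x => ?_) (.of_forall fun x => ?_)
    · have := (hφ k).continuous
      exact (by fun_prop : Continuous fun x => φ k (‖x‖ ^ 2) * D x).aestronglyMeasurable
    · rw [integrable_indicator_iff measurableSet_closedBall]
      exact hDc.abs.continuousOn.integrableOn_compact (isCompact_closedBall _ _)
    · by_cases hx : ‖x‖ ≤ t
      · rw [indicator_of_mem (by simpa using hx), norm_mul, Real.norm_eq_abs, Real.norm_eq_abs,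
          abs_of_nonneg (Real.smoothTransition.nonneg _)]
        exact mul_le_of_le_one_left (abs_nonneg _) (Real.smoothTransition.le_one _)
      · rw [indicator_of_notMem (by simpa using hx), hφt k _ (by gcongr; exact (not_le.1 hx).le)]
        simp
    · by_cases hx : ‖x‖ < t
      · rw [indicator_of_mem (by simpa using hx)]
        refine tendsto_const_nhds.congr' ?_
        filter_upwards [hφ1 (‖x‖ ^ 2) (by gcongr)] with k hk
        rw [hk, one_mul]
      · rw [indicator_of_notMem (by simpa using hx)]
        refine tendsto_const_nhds.congr fun k => ?_
        rw [hφt k _ (by gcongr; exact not_lt.1 hx), zero_mul]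
  refine le_of_tendsto hlim.abs ?_
  have hat' : (max a 0) ^ 2 < t ^ 2 := by
    have : max a 0 < t := max_lt hat ht
    gcongr
  filter_upwards [hφ1 _ hat'] with k hk
  refine (abs_integral_cutoff_le hf hΨ hΨ0 (hφ k) ht.le (hφt k)).trans ?_
  have hint : Integrable fun x => |2 * deriv (φ k) (‖x‖ ^ 2)| * ‖x‖ * G x := by
    have := (hφ k).continuous_deriv (by norm_num)
    refine Continuous.integrable_of_hasCompactSupport (by fun_prop)
      (HasCompactSupport.intro (isCompact_closedBall 0 t) fun x hx => ?_)
    have hx : t < ‖x‖ := by simpa using hx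
    have : deriv (φ k) (‖x‖ ^ 2) = 0 := by
      have : φ k =ᶠ[𝓝 (‖x‖ ^ 2)] fun _ => 0 := by
        filter_upwards [Ioi_mem_nhds (show t ^ 2 < ‖x‖ ^ 2 by gcongr)] with s hs
        exact hφt k s hs.le
      rw [this.deriv_eq, deriv_const]
    simp [this]
  refine (le_of_eq ?_).trans (integral_Ioi_abs_deriv_sq_mul_le (hφ k) (hφanti k) ht.le
    (a := max a 0) (fun s hs => ?_) (hφt k) hb0 hM0 fun r hr => ha r ⟨(le_max_left _ _).trans hr.1, hr.2⟩)
  · rw [integral_eq_integral_Ioi_toSphere volume hint, finrank_euclideanSpace_fin]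
    refine setIntegral_congr_fun measurableSet_Ioi fun r (hr : 0 < r) => ?_
    have hθ : ∀ θ : sphere (0 : EuclideanSpace ℝ (Fin n)) 1,
        ‖r • (θ : EuclideanSpace ℝ (Fin n))‖ = r := fun θ => by
      rw [norm_smul, norm_eq_of_mem_sphere, mul_one, Real.norm_of_nonneg hr.le]
    simp only [hθ, integral_const_mul, b, σ]
    ring
  · exact le_antisymm (Real.smoothTransition.le_one _) (hk ▸ hφanti k hs)

lemma exists_contDiff_eqOn_closedBall {E F : Type*} [NormedAddCommGroup E] [InnerProductSpace ℝ E]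
    [FiniteDimensional ℝ E] [NormedAddCommGroup F] [NormedSpace ℝ F] {U : Set E} (hU : IsOpen U)
    {R : ℝ} (hR : 0 < R) (hRU : closedBall 0 R ⊆ U) {f : E → F} {m : ℕ∞}
    (hf : ContDiffOn ℝ m f U) :
    ∃ g : E → F, ContDiff ℝ m g ∧ ∀ x ∈ closedBall (0 : E) R, g =ᶠ[𝓝 x] f := by
  obtain ⟨δ, hδ, hδU⟩ := (isCompact_closedBall (0 : E) R).exists_cthickening_subset_open hU hRU
  rw [cthickening_closedBall hδ.le hR.le] at hδU
  let χ : ContDiffBump (0 : E) := ⟨R + δ / 2, R + δ, by linarith, by linarith⟩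
  refine ⟨fun x => χ x • f x, ?_, fun x hx => ?_⟩
  · rw [contDiff_iff_contDiffAt]
    intro x
    by_cases hx : x ∈ U
    · exact χ.contDiff.contDiffAt.smul (hf.contDiffAt (hU.mem_nhds hx))
    · have hx' : x ∉ tsupport χ := fun h => hx (hδU (by
        rw [χ.tsupport_eq] at h
        simpa [χ, add_comm] using h))
      refine (contDiffAt_const (c := (0 : F))).congr_of_eventuallyEq ?_
      filter_upwards [(notMem_tsupport_iff_eventuallyEq.1 hx')] with y hy
      rw [hy]; simp
  · have : x ∈ ball (0 : E) χ.rIn := by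
      simp only [mem_closedBall, dist_zero_right, mem_ball] at hx ⊢
      change ‖x‖ < R + δ / 2
      linarith
    filter_upwards [χ.eventuallyEq_one_of_mem_ball this] with y hy
    rw [hy]; simp

end

/-- (Boundary estimate.) For `f ∈ C^∞(U,ℝⁿ)`,
`Ψ ∈ C¹([0,∞),[0,∞))` and `B̄(0,R) ⊆ U`, for almost every `t ∈ (0,R)`:
`|∫_{B(0,t)} (nΨ(|f|²)+2|f|²Ψ'(|f|²)) J_f dx|
  ≤ ∫_{∂B(0,t)} |f| Ψ(|f|²) ‖cof Df‖ dH^{n-1}`. -/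
theorem stmt9 (n : ℕ) (hn : 2 ≤ n)
    (U : Set (EuclideanSpace ℝ (Fin n))) (hUopen : IsOpen U)
    (R : ℝ) (hR : 0 < R)
    (hRU : closedBall (0 : EuclideanSpace ℝ (Fin n)) R ⊆ U)
    (f : EuclideanSpace ℝ (Fin n) → EuclideanSpace ℝ (Fin n))
    (hf : ContDiffOn ℝ (⊤ : ℕ∞) f U)
    (Ψ : ℝ → ℝ) (hΨ : ContDiffOn ℝ 1 Ψ (Set.Ici 0))
    (hΨnonneg : ∀ s ∈ Set.Ici (0 : ℝ), 0 ≤ Ψ s) :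
    ∀ᵐ t ∂(volume.restrict (Set.Ioo 0 R)),
      |∫ x in ball (0 : EuclideanSpace ℝ (Fin n)) t,
          ((n : ℝ) * Ψ (‖f x‖ ^ 2) + 2 * ‖f x‖ ^ 2 * derivWithin Ψ (Set.Ici 0) (‖f x‖ ^ 2)) *
          (jacobianMatrix f x).det| ≤
        ∫ x in sphere (0 : EuclideanSpace ℝ (Fin n)) t,
          ‖f x‖ * Ψ (‖f x‖ ^ 2) * matOpNorm (cofMatrix (jacobianMatrix f x))
          ∂(μH[(n : ℝ) - 1]) := by
  obtain ⟨g, hg, hgf⟩ := exists_contDiff_eqOn_closedBall hUopen hR hRU hf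
  have hval : ∀ x ∈ closedBall (0 : EuclideanSpace ℝ (Fin n)) R, g x = f x :=
    fun x hx => (hgf x hx).eq_of_nhds
  have hjac : ∀ x ∈ closedBall (0 : EuclideanSpace ℝ (Fin n)) R,
      jacobianMatrix g x = jacobianMatrix f x := fun x hx => by
    simp only [jacobianMatrix, (hgf x hx).fderiv_eq]
  refine (ae_restrict_iff' measurableSet_Ioo).2 (.of_forall fun t ht => ?_)
  have h := abs_setIntegral_ball_le_integral_sphere (one_le_two.trans hn)
    (hg.of_le (WithTop.coe_le_coe.2 (le_top : (2 : ℕ∞) ≤ ⊤))) hΨ hΨnonneg ht.1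
  rw [setIntegral_congr_fun (g := fun x => ((n : ℝ) * Ψ (‖f x‖ ^ 2) +
      2 * ‖f x‖ ^ 2 * derivWithin Ψ (Set.Ici 0) (‖f x‖ ^ 2)) * (jacobianMatrix f x).det)
      measurableSet_ball fun x hx => ?_,
    setIntegral_congr_fun (g := fun x =>
      ‖f x‖ * Ψ (‖f x‖ ^ 2) * matOpNorm (cofMatrix (jacobianMatrix f x)))
      isClosed_sphere.measurableSet fun x hx => ?_] at h
  · exact h
  · have hx' := closedBall_subset_closedBall ht.2.le (sphere_subset_closedBall hx)
    simp only [hval x hx', hjac x hx']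
  · have hx' := closedBall_subset_closedBall ht.2.le (ball_subset_closedBall hx)
    simp only [hval x hx', hjac x hx']
end
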